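/- Let F_0 and F_1 be classes of unimodal Kripke frames (in disjoint signatures {0} and {1}) closed under isomorphic copies and disjoint unions. If ∘→∘→∘ is a subframe of F_0 and ∘→∘ is a subframe of F_1, then the μ-calculus' alternation hierarchy is strict over the fusion F_0 ⊗ F_1: for every n ∈ ℕ there is a μ-formula in Σ^μ_{n+1} ∪ Π^μ_{n+1} which is not equivalent over F_0 ⊗ F_1 to any μ-formula in Σ^μ_n ∪ Π^μ_n. -/

import Mathlib

/- ### μ-calculus: syntax and Kripke semantics -/

/-- μ-formulas over a modal signature `Λ`, with propositional symbols and
variables indexed by `ℕ`; negation applies to propositional symbols only. -/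
inductive MuForm (Λ : Type) : Type where
  | prop : ℕ → MuForm Λ
  | nprop : ℕ → MuForm Λ
  | var : ℕ → MuForm Λ
  | and : MuForm Λ → MuForm Λ → MuForm Λ
  | or : MuForm Λ → MuForm Λ → MuForm Λ
  | box : Λ → MuForm Λ → MuForm Λ
  | dia : Λ → MuForm Λ → MuForm Λ
  | mu : ℕ → MuForm Λ → MuForm Λ
  | nu : ℕ → MuForm Λ → MuForm Λ

/-- A Kripke model over signature `Λ` with set of worlds `W`. -/
structure KModel (Λ W : Type) where
  R : Λ → W → W → Prop
  V : ℕ → Set W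

namespace MuForm

variable {Λ W : Type}

/-- The valuation `‖φ‖^M` of a μ-formula, where `env` interprets the variables;
least and greatest fixed points are taken in the complete lattice `Set W`. -/
def sem (M : KModel Λ W) (env : ℕ → Set W) : MuForm Λ → Set W
  | prop p => M.V p
  | nprop p => (M.V p)ᶜ
  | var x => env x
  | and a b => sem M env a ∩ sem M env b
  | or a b => sem M env a ∪ sem M env b
  | box i a => {w | ∀ v, M.R i w v → v ∈ sem M env a}
  | dia i a => {w | ∃ v, M.R i w v ∧ v ∈ sem M env a}
  | mu x a => sInf {A : Set W | sem M (Function.update env x A) a ⊆ A}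
  | nu x a => sSup {A : Set W | A ⊆ sem M (Function.update env x A) a}

/-- Free variables of a μ-formula. -/
def freeVars : MuForm Λ → Set ℕ
  | prop _ => ∅
  | nprop _ => ∅
  | var x => {x}
  | and a b => freeVars a ∪ freeVars b
  | or a b => freeVars a ∪ freeVars b
  | box _ a => freeVars a
  | dia _ a => freeVars a
  | mu x a => freeVars a \ {x}
  | nu x a => freeVars a \ {x}

/-- A μ-formula contains no fixed-point operators. -/
def noFix : MuForm Λ → Prop
  | prop _ => True
  | nprop _ => True
  | var _ => True
  | and a b => noFix a ∧ noFix b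
  | or a b => noFix a ∧ noFix b
  | box _ a => noFix a
  | dia _ a => noFix a
  | mu _ _ => False
  | nu _ _ => False

/-- The list of subformulas of a μ-formula. -/
def subfs : MuForm Λ → List (MuForm Λ)
  | prop p => [prop p]
  | nprop p => [nprop p]
  | var x => [var x]
  | and a b => (and a b) :: (subfs a ++ subfs b)
  | or a b => (or a b) :: (subfs a ++ subfs b)
  | box i a => (box i a) :: subfs a
  | dia i a => (dia i a) :: subfs a
  | mu x a => (mu x a) :: subfs a
  | nu x a => (nu x a) :: subfs a

/-- Substitution of `ψ` for the free occurrences of the variable `X`. -/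
def subst (X : ℕ) (ψ : MuForm Λ) : MuForm Λ → MuForm Λ
  | prop p => prop p
  | nprop p => nprop p
  | var y => if y = X then ψ else var y
  | and a b => and (subst X ψ a) (subst X ψ b)
  | or a b => or (subst X ψ a) (subst X ψ b)
  | box i a => box i (subst X ψ a)
  | dia i a => dia i (subst X ψ a)
  | mu y a => if y = X then mu y a else mu y (subst X ψ a)
  | nu y a => if y = X then nu y a else nu y (subst X ψ a)

/-- The substitution of `ψ` for `X` is capture-free: no free variable of `ψ`
becomes bound when substituting `ψ` for the free occurrences of `X`. -/
def CaptureFree (X : ℕ) (ψ : MuForm Λ) : MuForm Λ → Prop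
  | prop _ => True
  | nprop _ => True
  | var _ => True
  | and a b => CaptureFree X ψ a ∧ CaptureFree X ψ b
  | or a b => CaptureFree X ψ a ∧ CaptureFree X ψ b
  | box _ a => CaptureFree X ψ a
  | dia _ a => CaptureFree X ψ a
  | mu y a => y = X ∨ ((X ∈ freeVars a → y ∉ freeVars ψ) ∧ CaptureFree X ψ a)
  | nu y a => y = X ∨ ((X ∈ freeVars a → y ∉ freeVars ψ) ∧ CaptureFree X ψ a)

/-- Number of occurrences of the variable `X`. -/
def varCnt (X : ℕ) : MuForm Λ → ℕ
  | prop _ => 0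
  | nprop _ => 0
  | var y => if y = X then 1 else 0
  | and a b => varCnt X a + varCnt X b
  | or a b => varCnt X a + varCnt X b
  | box _ a => varCnt X a
  | dia _ a => varCnt X a
  | mu _ a => varCnt X a
  | nu _ a => varCnt X a

/-- Number of fixed-point binders binding the variable `X`. -/
def bndCnt (X : ℕ) : MuForm Λ → ℕ
  | prop _ => 0
  | nprop _ => 0
  | var _ => 0
  | and a b => bndCnt X a + bndCnt X b
  | or a b => bndCnt X a + bndCnt X b
  | box _ a => bndCnt X a
  | dia _ a => bndCnt X a
  | mu y a => (if y = X then 1 else 0) + bndCnt X a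
  | nu y a => (if y = X then 1 else 0) + bndCnt X a

end MuForm

/-- Each variable has at most one occurrence, is bound by at most one
fixed-point operator, and no variable occurs free. -/
def WellNamed {Λ : Type} (φ : MuForm Λ) : Prop :=
  (∀ X : ℕ, MuForm.varCnt X φ ≤ 1 ∧ MuForm.bndCnt X φ ≤ 1) ∧ MuForm.freeVars φ = ∅

/- ### The alternation hierarchy Σ^μ_n / Π^μ_n -/

mutual
  /-- The class `Σ^μ_n` of the alternation hierarchy. -/
  inductive SigmaMu {Λ : Type} : ℕ → MuForm Λ → Prop where
    | base {φ : MuForm Λ} : φ.noFix → SigmaMu 0 φ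
    | upS {n : ℕ} {φ : MuForm Λ} : SigmaMu n φ → SigmaMu (n + 1) φ
    | upP {n : ℕ} {φ : MuForm Λ} : PiMu n φ → SigmaMu (n + 1) φ
    | andI {n : ℕ} {a b : MuForm Λ} :
        SigmaMu (n + 1) a → SigmaMu (n + 1) b → SigmaMu (n + 1) (MuForm.and a b)
    | orI {n : ℕ} {a b : MuForm Λ} :
        SigmaMu (n + 1) a → SigmaMu (n + 1) b → SigmaMu (n + 1) (MuForm.or a b)
    | boxI {n : ℕ} {i : Λ} {a : MuForm Λ} :
        SigmaMu (n + 1) a → SigmaMu (n + 1) (MuForm.box i a)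
    | diaI {n : ℕ} {i : Λ} {a : MuForm Λ} :
        SigmaMu (n + 1) a → SigmaMu (n + 1) (MuForm.dia i a)
    | muI {n : ℕ} {X : ℕ} {a : MuForm Λ} :
        SigmaMu (n + 1) a → SigmaMu (n + 1) (MuForm.mu X a)
    | substI {n : ℕ} {X : ℕ} {a ψ : MuForm Λ} :
        SigmaMu (n + 1) a → SigmaMu (n + 1) ψ → MuForm.CaptureFree X ψ a →
        SigmaMu (n + 1) (MuForm.subst X ψ a)

  /-- The class `Π^μ_n` of the alternation hierarchy. -/
  inductive PiMu {Λ : Type} : ℕ → MuForm Λ → Prop where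
    | base {φ : MuForm Λ} : φ.noFix → PiMu 0 φ
    | upS {n : ℕ} {φ : MuForm Λ} : SigmaMu n φ → PiMu (n + 1) φ
    | upP {n : ℕ} {φ : MuForm Λ} : PiMu n φ → PiMu (n + 1) φ
    | andI {n : ℕ} {a b : MuForm Λ} :
        PiMu (n + 1) a → PiMu (n + 1) b → PiMu (n + 1) (MuForm.and a b)
    | orI {n : ℕ} {a b : MuForm Λ} :
        PiMu (n + 1) a → PiMu (n + 1) b → PiMu (n + 1) (MuForm.or a b)
    | boxI {n : ℕ} {i : Λ} {a : MuForm Λ} :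
        PiMu (n + 1) a → PiMu (n + 1) (MuForm.box i a)
    | diaI {n : ℕ} {i : Λ} {a : MuForm Λ} :
        PiMu (n + 1) a → PiMu (n + 1) (MuForm.dia i a)
    | nuI {n : ℕ} {X : ℕ} {a : MuForm Λ} :
        PiMu (n + 1) a → PiMu (n + 1) (MuForm.nu X a)
    | substI {n : ℕ} {X : ℕ} {a ψ : MuForm Λ} :
        PiMu (n + 1) a → PiMu (n + 1) ψ → MuForm.CaptureFree X ψ a →
        PiMu (n + 1) (MuForm.subst X ψ a)
end

/- ### Kripke frames, closure conditions, fusions, equivalence -/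

/-- A Kripke frame over the signature `Λ`. -/
structure Frame (Λ : Type) : Type 1 where
  World : Type
  R : Λ → World → World → Prop

/-- Frame isomorphism. -/
def FrameIso {Λ : Type} (F G : Frame Λ) : Prop :=
  ∃ e : F.World ≃ G.World, ∀ (i : Λ) (w v : F.World), F.R i w v ↔ G.R i (e w) (e v)

/-- A class of frames is closed under isomorphic copies. -/
def ClosedUnderIso {Λ : Type} (C : Set (Frame Λ)) : Prop :=
  ∀ F ∈ C, ∀ G : Frame Λ, FrameIso F G → G ∈ C

/-- Disjoint union of a family of frames. -/
def Frame.disjUnion {Λ ι : Type} (f : ι → Frame Λ) : Frame Λ where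
  World := Σ i : ι, (f i).World
  R m x y :=
    ∃ h : x.1 = y.1, (f y.1).R m (cast (congrArg (fun i => (f i).World) h) x.2) y.2

/-- A class of frames is closed under disjoint unions. -/
def ClosedUnderDU {Λ : Type} (C : Set (Frame Λ)) : Prop :=
  ∀ (ι : Type) (f : ι → Frame Λ), (∀ i, f i ∈ C) → Frame.disjUnion f ∈ C

/-- `∘→∘` is a subframe of the class `C` of unimodal frames. -/
def HasEdge (C : Set (Frame Unit)) : Prop :=
  ∃ F ∈ C, ∃ w0 w1 : F.World, w0 ≠ w1 ∧ F.R () w0 w1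

/-- `∘←∘→∘` is a subframe of the class `C` of unimodal frames. -/
def HasFork (C : Set (Frame Unit)) : Prop :=
  ∃ F ∈ C, ∃ w0 w1 w2 : F.World,
    w0 ≠ w1 ∧ w0 ≠ w2 ∧ w1 ≠ w2 ∧ F.R () w0 w1 ∧ F.R () w0 w2

/-- `∘→∘→∘` is a subframe of the class `C` of unimodal frames. -/
def HasChain2 (C : Set (Frame Unit)) : Prop :=
  ∃ F ∈ C, ∃ w0 w1 w2 : F.World,
    w0 ≠ w1 ∧ w0 ≠ w2 ∧ w1 ≠ w2 ∧ F.R () w0 w1 ∧ F.R () w1 w2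

/-- The unimodal reduct of a bimodal frame. -/
def Frame.reduct2 (F : Frame (Fin 2)) (i : Fin 2) : Frame Unit :=
  ⟨F.World, fun _ => F.R i⟩

/-- Fusion of two classes of unimodal frames (signatures `{0}` and `{1}`). -/
def fusion2 (C0 C1 : Set (Frame Unit)) : Set (Frame (Fin 2)) :=
  {F | F.reduct2 0 ∈ C0 ∧ F.reduct2 1 ∈ C1}

/-- The unimodal reduct of a trimodal frame. -/
def Frame.reduct3 (F : Frame (Fin 3)) (i : Fin 3) : Frame Unit :=
  ⟨F.World, fun _ => F.R i⟩

/-- Fusion of three classes of unimodal frames. -/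
def fusion3 (C0 C1 C2 : Set (Frame Unit)) : Set (Frame (Fin 3)) :=
  {F | F.reduct3 0 ∈ C0 ∧ F.reduct3 1 ∈ C1 ∧ F.reduct3 2 ∈ C2}

/-- Two μ-formulas are equivalent over a class of frames: they have the same
valuation in every model based on a frame of the class. -/
def EquivOver {Λ : Type} (C : Set (Frame Λ)) (φ ψ : MuForm Λ) : Prop :=
  ∀ F ∈ C, ∀ (V : ℕ → Set F.World) (env : ℕ → Set F.World),
    MuForm.sem ⟨F.R, V⟩ env φ = MuForm.sem ⟨F.R, V⟩ env ψ

/- ### Games, strategies, evaluation games, parity games -/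

/-- A two-player game on a graph: positions owned by `ownV` belong to
Verifier/∃, the others to Refuter/∀; `winV` decides infinite plays.
A player who cannot move loses. -/
structure Game (Pos : Type) where
  init : Pos
  ownV : Pos → Prop
  move : Pos → Pos → Prop
  winV : (ℕ → Pos) → Prop

/-- The history (current position first) of an infinite play after `n` steps. -/
def histN {Pos : Type} (p : ℕ → Pos) (n : ℕ) : List Pos :=
  ((List.range (n + 1)).map p).reverse

/-- Finite histories (current position first) of plays in which the player
owning the `own`-positions follows the strategy `σ`. -/
inductive Game.Hist {Pos : Type} (G : Game Pos) (own : Pos → Prop)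
    (σ : List Pos → Pos) : List Pos → Prop where
  | init : Game.Hist G own σ [G.init]
  | smove {l : List Pos} {x : Pos} : Game.Hist G own σ (x :: l) → own x →
      G.move x (σ (x :: l)) → Game.Hist G own σ (σ (x :: l) :: x :: l)
  | omove {l : List Pos} {x y : Pos} : Game.Hist G own σ (x :: l) → ¬ own x →
      G.move x y → Game.Hist G own σ (y :: x :: l)

/-- The player owning the `own`-positions has a winning strategy:
a strategy which always provides a legal move at reachable own positions
(so the player is never stuck) and such that every infinite play following it
satisfies the winning condition `winO`; finite plays in which the opponent is
stuck are automatically won. -/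
def Game.WinsFor {Pos : Type} (G : Game Pos) (own : Pos → Prop)
    (winO : (ℕ → Pos) → Prop) : Prop :=
  ∃ σ : List Pos → Pos,
    (∀ (l : List Pos) (x : Pos), G.Hist own σ (x :: l) → own x →
      G.move x (σ (x :: l))) ∧
    (∀ p : ℕ → Pos, p 0 = G.init → (∀ n, G.move (p n) (p (n + 1))) →
      (∀ n, own (p n) → p (n + 1) = σ (histN p n)) → winO p)

/-- Verifier has a winning strategy. -/
def Game.VWins {Pos : Type} (G : Game Pos) : Prop := G.WinsFor G.ownV G.winV

/-- Refuter has a winning strategy. -/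
def Game.RWins {Pos : Type} (G : Game Pos) : Prop :=
  G.WinsFor (fun x => ¬ G.ownV x) (fun p => ¬ G.winV p)

/-- Ownership of positions in the evaluation game `𝒢(M, w ⊨ φ0)`:
Verifier owns disjunctions, diamonds, μ-formulas, μ-bound variables and
false literals. -/
def evalOwnV {Λ W : Type} (M : KModel Λ W) (φ0 : MuForm Λ) :
    MuForm Λ × W → Prop := fun q =>
  match q with
  | (.or _ _, _) => True
  | (.dia _ _, _) => True
  | (.mu _ _, _) => True
  | (.var X, _) => ∃ a : MuForm Λ, (MuForm.mu X a) ∈ φ0.subfs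
  | (.prop p, w) => w ∉ M.V p
  | (.nprop p, w) => w ∈ M.V p
  | _ => False

/-- Admissible moves in the evaluation game `𝒢(M, w ⊨ φ0)`. -/
def evalMove {Λ W : Type} (M : KModel Λ W) (φ0 : MuForm Λ) :
    MuForm Λ × W → MuForm Λ × W → Prop := fun q r =>
  match q with
  | (.and a b, w) => r = (a, w) ∨ r = (b, w)
  | (.or a b, w) => r = (a, w) ∨ r = (b, w)
  | (.box i a, w) => ∃ v, M.R i w v ∧ r = (a, v)
  | (.dia i a, w) => ∃ v, M.R i w v ∧ r = (a, v)
  | (.mu _ a, w) => r = (a, w)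
  | (.nu _ a, w) => r = (a, w)
  | (.var X, w) =>
      ∃ a : MuForm Λ,
        ((MuForm.mu X a) ∈ φ0.subfs ∧ r = (MuForm.mu X a, w)) ∨
        ((MuForm.nu X a) ∈ φ0.subfs ∧ r = (MuForm.nu X a, w))
  | (.prop _, _) => False
  | (.nprop _, _) => False

/-- The formula `ψ` labels infinitely many positions of the infinite run `p`. -/
def InfOccF {Λ W : Type} (p : ℕ → MuForm Λ × W) (ψ : MuForm Λ) : Prop :=
  ∀ n, ∃ m, n ≤ m ∧ (p m).1 = ψ

/-- Verifier wins an infinite run iff the outermost fixed-point subformula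
occurring infinitely often is a ν-formula. -/
def evalWinV {Λ W : Type} (p : ℕ → MuForm Λ × W) : Prop :=
  ∃ (X : ℕ) (a : MuForm Λ), InfOccF p (MuForm.nu X a) ∧
    ∀ χ : MuForm Λ, InfOccF p χ → χ ∈ (MuForm.nu X a).subfs

/-- The evaluation game `𝒢(M, w ⊨ φ)`. -/
def evalGame {Λ W : Type} (M : KModel Λ W) (w : W) (φ : MuForm Λ) :
    Game (MuForm Λ × W) where
  init := (φ, w)
  ownV := evalOwnV M φ
  move := evalMove M φ
  winV := evalWinV

/-- A parity game. -/
structure PGame : Type 1 where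
  Pos : Type
  ownE : Pos → Prop
  init : Pos
  E : Pos → Pos → Prop
  Ω : Pos → ℕ

/-- The parity `k` occurs infinitely often in the infinite play `p`. -/
def InfOccPar (P : PGame) (p : ℕ → P.Pos) (k : ℕ) : Prop :=
  ∀ n, ∃ m, n ≤ m ∧ P.Ω (p m) = k

/-- A parity game as a game: ∃ wins an infinite play iff the greatest parity
occurring infinitely often is even. -/
def PGame.toGame (P : PGame) : Game P.Pos where
  init := P.init
  ownV := P.ownE
  move := P.E
  winV := fun p => ∃ k, Even k ∧ InfOccPar P p k ∧ ∀ j, InfOccPar P p j → j ≤ k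

/-- Player ∃ wins the parity game. -/
def PGame.ExWins (P : PGame) : Prop := P.toGame.VWins

/-- Player ∀ wins the parity game. -/
def PGame.AWins (P : PGame) : Prop := P.toGame.RWins

/-- The parity of a fixed-point formula: `2(i+ε) − 1` for a μ-formula in
`Σ^μ_{2i+ε} \ Π^μ_{2i+ε}`, `2i` for a ν-formula in `Π^μ_{2i+ε} \ Σ^μ_{2i+ε}`,
and `0` for non fixed-point formulas. -/
noncomputable def fpParity {Λ : Type} : MuForm Λ → ℕ := fun φ =>
  match φ with
  | .mu _ _ =>
      (fun ℓ => if Even ℓ then ℓ - 1 else ℓ) (sInf {k | SigmaMu k φ ∧ ¬ PiMu k φ})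
  | .nu _ _ =>
      (fun ℓ => if Even ℓ then ℓ else ℓ - 1) (sInf {k | PiMu k φ ∧ ¬ SigmaMu k φ})
  | _ => 0

/-- The evaluation game `𝒢(M, w ⊨ φ)` presented as the parity game
`𝒢^P(M, w ⊨ φ)`. -/
noncomputable def evalPGame {Λ W : Type} (M : KModel Λ W) (w : W)
    (φ : MuForm Λ) : PGame where
  Pos := MuForm Λ × W
  ownE := evalOwnV M φ
  init := (φ, w)
  E := evalMove M φ
  Ω := fun q => fpParity q.1

/- ### Tree unfolding of a parity game -/

/-- Finite `E`-paths of a parity game starting at the initial position,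
presented as (last vertex, reversed list of earlier vertices). -/
inductive IsUPath (P : PGame) : P.Pos × List P.Pos → Prop where
  | init : IsUPath P (P.init, [])
  | cons {u : P.Pos} {t : List P.Pos} {v : P.Pos} :
      IsUPath P (u, t) → P.E u v → IsUPath P (v, u :: t)

/-- The tree unfolding of a parity game: positions are the finite `E`-paths
starting at the initial position, with ownership and parity inherited from
the last vertex. -/
def PGame.unfold (P : PGame) : PGame where
  Pos := {q : P.Pos × List P.Pos // IsUPath P q}
  ownE := fun q => P.ownE q.val.1
  init := ⟨(P.init, []), IsUPath.init⟩
  E := fun q r => r.val.2 = q.val.1 :: q.val.2 ∧ P.E q.val.1 r.val.1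
  Ω := fun q => P.Ω q.val.1

/- ### The Kripke encoding of parity games and the formulas W_n -/

/- Propositional indices used for the encoding:
`bd = 0`, `pos = 1`, `pre₀ = 2`, `nxt₀ = 3`, `pre₁ = 4`, `nxt₁ = 5`,
`P_∃ = 6`, `P_∀ = 7`, `P_j = 8 + j`. -/

/-- Worlds of the Kripke model encoding a parity game: a world `pos v` for
each position `v`, and intermediate choice/confirmation worlds `mid u u'`
for the edges. -/
inductive EncW (Pos : Type) : Type where
  | pos : Pos → EncW Pos
  | mid : Pos → Pos → EncW Pos

/-- Choice steps (`R₀`) of the encoding. -/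
def encR0 (P : PGame) : EncW P.Pos → EncW P.Pos → Prop
  | EncW.pos v, EncW.mid u u' => v = u ∧ P.E u u'
  | _, _ => False

/-- Confirmation steps (`R₁`) of the encoding. -/
def encR1 (P : PGame) : EncW P.Pos → EncW P.Pos → Prop
  | EncW.mid u u', EncW.pos v => v = u' ∧ P.E u u'
  | _, _ => False

/-- Valuation of the encoding. -/
def encV (P : PGame) : ℕ → Set (EncW P.Pos) := fun n =>
  if n = 0 then Set.univ                                         -- bd
  else if n = 1 then {x | ∃ v, x = EncW.pos v}                   -- pos
  else if n = 2 then {x | ∃ v, x = EncW.pos v}                   -- pre₀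
  else if n = 3 then {x | ∃ u u', x = EncW.mid u u'}             -- nxt₀
  else if n = 4 then {x | ∃ u u', x = EncW.mid u u'}             -- pre₁
  else if n = 5 then {x | ∃ v, x = EncW.pos v}                   -- nxt₁
  else if n = 6 then {x | ∃ v, x = EncW.pos v ∧ P.ownE v}        -- P_∃
  else if n = 7 then {x | ∃ v, x = EncW.pos v ∧ ¬ P.ownE v}      -- P_∀
  else {x | ∃ v, x = EncW.pos v ∧ P.Ω v = n - 8}                 -- P_{n-8}

/-- The bimodal Kripke model `P^K` encoding the parity game `P`. -/
def encModel (P : PGame) : KModel (Fin 2) (EncW P.Pos) where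
  R := fun i => if i = 0 then encR0 P else encR1 P
  V := encV P

/-- `♦φ := νY. pre₀ ∧ bd ∧ ◇₀(nxt₀ ∧ pre₁ ∧ bd ∧ ◇₁(nxt₁ ∧ bd ∧
((Y ∧ ¬pos) ∨ (φ ∧ pos))))`. -/
def DiamW (Y : ℕ) (φ : MuForm (Fin 2)) : MuForm (Fin 2) :=
  .nu Y (.and (.prop 2) (.and (.prop 0)
    (.dia 0 (.and (.prop 3) (.and (.prop 4) (.and (.prop 0)
      (.dia 1 (.and (.prop 5) (.and (.prop 0)
        (.or (.and (.var Y) (.nprop 1)) (.and φ (.prop 1))))))))))))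

/-- `■φ := νY. (pre₀ ∧ bd → □₀(nxt₀ ∧ pre₁ ∧ bd → □₁(nxt₁ ∧ bd →
((Y ∧ ¬pos) ∧ (φ ∧ pos)))))`, implications written disjunctively. -/
def BoxW (Y : ℕ) (φ : MuForm (Fin 2)) : MuForm (Fin 2) :=
  .nu Y (.or (.or (.nprop 2) (.nprop 0))
    (.box 0 (.or (.or (.nprop 3) (.or (.nprop 4) (.nprop 0)))
      (.box 1 (.or (.or (.nprop 5) (.nprop 0))
        (.and (.and (.var Y) (.nprop 1)) (.and φ (.prop 1))))))))

/-- The `j`-th disjunct `(P_j ∧ P_∃ ∧ ♦X_j) ∨ (P_j ∧ P_∀ ∧ ■X_j)`. -/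
def WDisj (Y j : ℕ) : MuForm (Fin 2) :=
  .or (.and (.prop (8 + j)) (.and (.prop 6) (DiamW Y (.var j))))
      (.and (.prop (8 + j)) (.and (.prop 7) (BoxW Y (.var j))))

/-- The disjunction `⋁_{0 ≤ j ≤ n} [(P_j ∧ P_∃ ∧ ♦X_j) ∨ (P_j ∧ P_∀ ∧ ■X_j)]`. -/
def WBody (Y : ℕ) : ℕ → MuForm (Fin 2)
  | 0 => WDisj Y 0
  | j + 1 => .or (WBody Y (j)) (WDisj Y (j + 1))

/-- The alternating block of binders `ηX_n … νX_2 μX_1 νX_0`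
(`νX_j` for even `j`, `μX_j` for odd `j`). -/
def WBind : ℕ → MuForm (Fin 2) → MuForm (Fin 2)
  | 0, φ => .nu 0 φ
  | j + 1, φ =>
      if Even (j + 1) then .nu (j + 1) (WBind j φ) else .mu (j + 1) (WBind j φ)

/-- The winning region formula
`W_n := ηX_n … νX_2 μX_1 νX_0. ⋁_{0≤j≤n} [(P_j ∧ P_∃ ∧ ♦X_j) ∨ (P_j ∧ P_∀ ∧ ■X_j)]`,
where the fresh variable `Y` of `♦`/`■` is `n + 1`. -/
def Wfml (n : ℕ) : MuForm (Fin 2) := WBind n (WBody (n + 1) n)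

/- ### Pointed bimodal models, restriction, isomorphisms, the map f_φ -/

/-- A pointed bimodal Kripke model. -/
structure PModel : Type 1 where
  World : Type
  R0 : World → World → Prop
  R1 : World → World → Prop
  V : ℕ → Set World
  pt : World

/-- The underlying bimodal Kripke model. -/
def PModel.toK (M : PModel) : KModel (Fin 2) M.World :=
  ⟨fun i => if i = 0 then M.R0 else M.R1, M.V⟩

/-- The edges of the graph of a pointed bimodal model. -/
def PModel.edge (M : PModel) (x y : M.World) : Prop := M.R0 x y ∨ M.R1 x y

/-- The graph of the model has no loops. -/
def PModel.Acyclic (M : PModel) : Prop :=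
  ∀ x : M.World, ¬ Relation.TransGen M.edge x x

/-- Reachability in at most `k` steps. -/
def stepsLe (M : PModel) : ℕ → M.World → M.World → Prop
  | 0 => fun x y => x = y
  | k + 1 => fun x y => stepsLe M k x y ∨ ∃ u, stepsLe M k x u ∧ M.edge u y

/-- The worlds at distance less than `n` from the distinguished point. -/
def PModel.ball (M : PModel) (n : ℕ) : Set M.World :=
  {v | ∃ k, k + 1 ≤ n ∧ stepsLe M k M.pt v}

/-- `e` is an isomorphism between the restrictions `(M↾n, w)` and `(M'↾n, w')`,
i.e. an `n`-isomorphism. -/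
structure IsNIso (M M' : PModel) (n : ℕ)
    (e : {x // x ∈ M.ball n} ≃ {x // x ∈ M'.ball n}) : Prop where
  pt : ∀ hx : M.pt ∈ M.ball n, (e ⟨M.pt, hx⟩).val = M'.pt
  r0 : ∀ x y : {x // x ∈ M.ball n}, M.R0 x.val y.val ↔ M'.R0 (e x).val (e y).val
  r1 : ∀ x y : {x // x ∈ M.ball n}, M.R1 x.val y.val ↔ M'.R1 (e x).val (e y).val
  vals : ∀ (p : ℕ) (x : {x // x ∈ M.ball n}), x.val ∈ M.V p ↔ (e x).val ∈ M'.V p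

/-- The pointed models are `n`-isomorphic. -/
def NIsomorphic (M M' : PModel) (n : ℕ) : Prop := ∃ e, IsNIso M M' n e

/-- `e` is an isomorphism of pointed bimodal models. -/
structure IsIsoP (M M' : PModel) (e : M.World ≃ M'.World) : Prop where
  pt : e M.pt = M'.pt
  r0 : ∀ x y : M.World, M.R0 x y ↔ M'.R0 (e x) (e y)
  r1 : ∀ x y : M.World, M.R1 x y ↔ M'.R1 (e x) (e y)
  vals : ∀ (p : ℕ) (x : M.World), x ∈ M.V p ↔ e x ∈ M'.V p

/-- The pointed models are isomorphic. -/
def IsomorphicP (M M' : PModel) : Prop := ∃ e, IsIsoP M M' e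

/-- The map `f_φ` sending a pointed bimodal model `(M, w)` to the pointed
Kripke model `(𝒢^K(M, w ⊨ φ), ⟨φ, w⟩)` representing its evaluation game,
where `𝒢^K(M, w ⊨ φ) = (𝒢^P(M, w ⊨ φ))^K`. -/
noncomputable def fGame (φ : MuForm (Fin 2)) (M : PModel) : PModel where
  World := EncW (MuForm (Fin 2) × M.World)
  R0 := encR0 (evalPGame M.toK M.pt φ)
  R1 := encR1 (evalPGame M.toK M.pt φ)
  V := encV (evalPGame M.toK M.pt φ)
  pt := EncW.pos (φ, M.pt)

/- ### Modal logics, fusions of logics, GLP -/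

/-- Modal formulas (no fixed points) over a signature `I`, with full
implication and falsum. -/
inductive MForm (I : Type) : Type where
  | prop : ℕ → MForm I
  | fls : MForm I
  | imp : MForm I → MForm I → MForm I
  | box : I → MForm I → MForm I

namespace MForm

variable {I : Type}

def neg (a : MForm I) : MForm I := a.imp .fls

def conj (a b : MForm I) : MForm I := (a.imp b.neg).neg

def diam (i : I) (a : MForm I) : MForm I := (MForm.box i a.neg).neg

def iff (a b : MForm I) : MForm I := conj (a.imp b) (b.imp a)

/-- Kripke semantics for modal formulas. -/
def semM {W : Type} (R : I → W → W → Prop) (V : ℕ → Set W) : MForm I → Set W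
  | prop p => V p
  | fls => ∅
  | imp a b => {w | w ∈ semM R V a → w ∈ semM R V b}
  | box i a => {w | ∀ v, R i w v → v ∈ semM R V a}

/-- Uniform substitution of formulas for propositional symbols. -/
def substP (σ : ℕ → MForm I) : MForm I → MForm I
  | prop p => σ p
  | fls => fls
  | imp a b => imp (substP σ a) (substP σ b)
  | box i a => box i (substP σ a)

/-- The formula only uses modalities from `S`. -/
def UsesOnly (S : Set I) : MForm I → Prop
  | prop _ => True
  | fls => True
  | imp a b => UsesOnly S a ∧ UsesOnly S b
  | box i a => i ∈ S ∧ UsesOnly S a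

/-- The propositional symbol `x` occurs in the formula. -/
def PropOccurs (x : ℕ) : MForm I → Prop
  | prop p => p = x
  | fls => False
  | imp a b => PropOccurs x a ∨ PropOccurs x b
  | box _ a => PropOccurs x a

/-- Every occurrence of the propositional symbol `x` is within the scope of
some modality. -/
def Guarded (x : ℕ) : MForm I → Prop
  | prop p => p ≠ x
  | fls => True
  | imp a b => Guarded x a ∧ Guarded x b
  | box _ _ => True

end MForm

/-- Propositional tautologies: formulas true under every boolean valuation
treating propositional symbols and boxed formulas as atoms. -/
def IsTaut {I : Type} (φ : MForm I) : Prop :=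
  ∀ val : MForm I → Prop, ¬ val .fls →
    (∀ a b : MForm I, val (a.imp b) ↔ (val a → val b)) → val φ

/-- A modal formula is valid on a frame: it holds at every world under
every valuation. -/
def ValidOn {I : Type} (F : Frame I) (φ : MForm I) : Prop :=
  ∀ (V : ℕ → Set F.World) (w : F.World), w ∈ MForm.semM F.R V φ

/-- `L` is a normal modal logic in the signature `S`. -/
structure IsNormalIn {I : Type} (S : Set I) (L : Set (MForm I)) : Prop where
  inSig : ∀ φ ∈ L, MForm.UsesOnly S φ
  taut : ∀ φ : MForm I, MForm.UsesOnly S φ → IsTaut φ → φ ∈ L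
  axK : ∀ i ∈ S, ∀ a b : MForm I, MForm.UsesOnly S a → MForm.UsesOnly S b →
    ((MForm.box i (a.imp b)).imp ((MForm.box i a).imp (MForm.box i b))) ∈ L
  mp : ∀ a b : MForm I, a ∈ L → (a.imp b) ∈ L → b ∈ L
  nec : ∀ i ∈ S, ∀ a : MForm I, a ∈ L → MForm.box i a ∈ L
  subst : ∀ σ : ℕ → MForm I, (∀ p, MForm.UsesOnly S (σ p)) →
    ∀ a ∈ L, a.substP σ ∈ L

/-- The fusion of a family of modal logics: the smallest normal modal logic
in the combined signature containing each of them. -/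
def FusionLogic {I J : Type} (Ls : J → Set (MForm I)) : Set (MForm I) :=
  ⋂₀ {L : Set (MForm I) | IsNormalIn Set.univ L ∧ ∀ j, Ls j ⊆ L}

/-- Extension of a frame for the `j`-th component signature to the full
signature (the other relations are empty; validity of formulas in the
component signature is unaffected). -/
def extendFrame {I J : Type} (c : I → J) (j : J)
    (F : Frame {i : I // c i = j}) : Frame I :=
  ⟨F.World, fun i w v => ∃ h : c i = j, F.R ⟨i, h⟩ w v⟩

/-- The reduct of a frame for the full signature to the `j`-th component. -/
def Frame.reductTo {I J : Type} (c : I → J) (j : J) (F : Frame I) :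
    Frame {i : I // c i = j} :=
  ⟨F.World, fun i => F.R i.val⟩

/-- `L` is characterized by the class `Fs` of frames in the `j`-th component
signature: `L` consists exactly of the formulas of that signature valid on
every frame of `Fs`. -/
def CharacterizedBy {I J : Type} (c : I → J) (j : J) (L : Set (MForm I))
    (Fs : Set (Frame {i : I // c i = j})) : Prop :=
  L = {φ | MForm.UsesOnly {i | c i = j} φ ∧
        ∀ F ∈ Fs, ValidOn (extendFrame c j F) φ}

/-- The fusion of classes of frames in pairwise disjoint signatures. -/
def FusionFrames {I J : Type} (c : I → J)
    (Fs : ∀ j : J, Set (Frame {i : I // c i = j})) : Set (Frame I) :=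
  {F | ∀ j, F.reductTo c j ∈ Fs j}

/-- The finite model property for a logic in signature `S`. -/
def HasFMP {I : Type} (S : Set I) (L : Set (MForm I)) : Prop :=
  ∀ φ : MForm I, MForm.UsesOnly S φ → φ ∉ L →
    ∃ (W : Type) (_ : Finite W) (R : I → W → W → Prop) (V : ℕ → Set W),
      (∀ ψ ∈ L, ∀ w : W, w ∈ MForm.semM R V ψ) ∧ ∃ w : W, w ∉ MForm.semM R V φ

/-- The provability logic `GLP` (signature `ℕ`). -/
inductive GLPthm : MForm ℕ → Prop where
  | taut {φ : MForm ℕ} : IsTaut φ → GLPthm φ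
  | axK (n : ℕ) (a b : MForm ℕ) :
      GLPthm ((MForm.box n (a.imp b)).imp ((MForm.box n a).imp (MForm.box n b)))
  | axLob (n : ℕ) (a : MForm ℕ) :
      GLPthm ((MForm.box n ((MForm.box n a).imp a)).imp (MForm.box n a))
  | axMono {m n : ℕ} (h : m ≤ n) (a : MForm ℕ) :
      GLPthm ((MForm.box m a).imp (MForm.box n a))
  | axStab {m n : ℕ} (h : m ≤ n) (a : MForm ℕ) :
      GLPthm ((MForm.box m a).imp (MForm.box n (MForm.box m a)))
  | axStabD {m n : ℕ} (h : m ≤ n) (a : MForm ℕ) :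
      GLPthm ((MForm.diam m a).imp (MForm.box n (MForm.diam m a)))
  | mp {a b : MForm ℕ} : GLPthm (a.imp b) → GLPthm a → GLPthm b
  | nec (n : ℕ) {a : MForm ℕ} : GLPthm a → GLPthm (MForm.box n a)
  | subst (σ : ℕ → MForm ℕ) {a : MForm ℕ} : GLPthm a → GLPthm (a.substP σ)

/- ### Frame classes for the standard modal logics -/

def FK : Set (Frame Unit) := Set.univ
def FK4 : Set (Frame Unit) := {F | Transitive (F.R ())}
def FS4 : Set (Frame Unit) := {F | Reflexive (F.R ()) ∧ Transitive (F.R ())}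
def FKD45 : Set (Frame Unit) :=
  {F | (∀ w, ∃ v, F.R () w v) ∧ Transitive (F.R ()) ∧
    (∀ w v u, F.R () w v → F.R () w u → F.R () v u)}
def FS5 : Set (Frame Unit) := {F | Equivalence (F.R ())}
def FGL : Set (Frame Unit) :=
  {F | Transitive (F.R ()) ∧ ¬ ∃ f : ℕ → F.World, ∀ k, F.R () (f k) (f (k + 1))}


/- ### Proof of the strictness theorem -/

namespace AHS

set_option linter.unusedVariables false

section Fix

variable {L L' : Type} [CompleteLattice L] [CompleteLattice L']

def leb (b : Bool) (x y : L) : Prop := match b with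
  | true => x ≤ y
  | false => y ≤ x

def fx (b : Bool) (G : L → L) : L := match b with
  | true => sInf {A | G A ≤ A}
  | false => sSup {A | A ≤ G A}

theorem leb_refl (b : Bool) (x : L) : leb b x x := by cases b <;> simp [leb]

theorem leb_trans {b : Bool} {x y z : L} (h1 : leb b x y) (h2 : leb b y z) : leb b x z := by
  cases b
  · exact le_trans (α := L) h2 h1
  · exact le_trans (α := L) h1 h2

theorem leb_antisymm {b : Bool} {x y : L} (h1 : leb b x y) (h2 : leb b y x) : x = y := by
  cases b
  · exact le_antisymm (α := L) h2 h1
  · exact le_antisymm (α := L) h1 h2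

theorem leb_mono {b : Bool} {G : L → L'} (hG : Monotone G) {x y : L} (h : leb b x y) :
    leb b (G x) (G y) := by
  cases b <;> exact hG h

theorem fx_fix {b : Bool} {G : L → L} (hG : Monotone G) : G (fx b G) = fx b G := by
  cases b
  · exact OrderHom.map_gfp ⟨G, hG⟩
  · exact OrderHom.map_lfp ⟨G, hG⟩

theorem fx_least {b : Bool} {G : L → L} {A : L} (h : leb b (G A) A) : leb b (fx b G) A := by
  cases b
  · exact le_sSup (α := L) h
  · exact sInf_le (α := L) h

theorem fx_unique {b : Bool} {G : L → L} {z : L} (hG : Monotone G) (hz : G z = z)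
    (hl : ∀ A, G A = A → leb b z A) : fx b G = z :=
  leb_antisymm (fx_least (by rw [hz]; exact leb_refl b z)) (hl _ (fx_fix hG))

theorem fx_mono {b : Bool} {G G' : L → L} (hG' : Monotone G') (h : ∀ x, G x ≤ G' x) :
    fx b G ≤ fx b G' := by
  cases b
  · exact sSup_le_sSup fun A hA => le_trans hA (h A)
  · exact sInf_le_sInf fun A hA => le_trans (h A) hA

theorem leb_prod {b : Bool} {p q : L × L'} (h1 : leb b p.1 q.1) (h2 : leb b p.2 q.2) :
    leb b p q := by
  cases b <;> exact ⟨h1, h2⟩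

theorem fx_tri {b : Bool} {H : L → L' → L} {K : L' → L'}
    (hH : ∀ u u' v v', u ≤ u' → v ≤ v' → H u v ≤ H u' v') (hK : Monotone K) :
    fx b (fun p : L × L' => (H p.1 p.2, K p.2)) = (fx b (fun u => H u (fx b K)), fx b K) := by
  apply fx_unique
  · intro p q hpq
    exact ⟨hH _ _ _ _ hpq.1 hpq.2, hK hpq.2⟩
  · have h1 : Monotone (fun u => H u (fx b K)) := fun u u' h => hH _ _ _ _ h le_rfl
    exact Prod.ext (fx_fix h1) (fx_fix hK)
  · rintro ⟨u, v⟩ h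
    have h1 : H u v = u := congrArg Prod.fst h
    have h2 : K v = v := congrArg Prod.snd h
    have h3 : leb b (fx b K) v := fx_least (by rw [h2]; exact leb_refl b v)
    refine leb_prod ?_ h3
    apply fx_least
    show leb b (H u (fx b K)) u
    have h4 : leb b (H u (fx b K)) (H u v) :=
      leb_mono (G := fun v => H u v) (fun v v' hv => hH _ _ _ _ le_rfl hv) h3
    rwa [h1] at h4

theorem fx_diag {b : Bool} {G : L → L → L} (hG : ∀ u u' v v', u ≤ u' → v ≤ v' → G u v ≤ G u' v') :
    fx b (fun u => G u u) = fx b (fun u => fx b (fun v => G u v)) := by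
  have m1 : ∀ u, Monotone (fun v => G u v) := fun u v v' h => hG _ _ _ _ le_rfl h
  have m2 : Monotone (fun u => fx b (fun v => G u v)) := fun u u' h =>
    fx_mono (m1 u') (fun x => hG _ _ _ _ h le_rfl)
  have m3 : Monotone (fun u => G u u) := fun u u' h => hG _ _ _ _ h h
  symm
  apply fx_unique m2
  · apply leb_antisymm (b := b)
    · apply fx_least
      have := fx_fix (b := b) m3
      try simp only at this
      rw [this]; exact leb_refl _ _
    · have h5 := fx_fix (b := b) (m1 (fx b fun u => G u u))
      try simp only at h5
      set z := fx b (fun u => G u u) with hz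
      set y := fx b (fun v => G z v) with hy
      have h6 : leb b y z := by
        apply fx_least
        have := fx_fix (b := b) m3
        try simp only at this
        rw [← hz] at this
        rw [this]; exact leb_refl _ _
      rw [hz]
      apply fx_least
      have h7 : leb b (G y y) (G z y) :=
        leb_mono (G := fun u => G u y) (fun _ _ h => hG _ _ _ _ h le_rfl) h6
      rwa [h5] at h7
  · intro A hA
    try simp only at hA
    apply fx_least
    have h5 := fx_fix (b := b) (m1 A)
    try simp only at h5
    rw [hA] at h5
    rw [h5]; exact leb_refl _ _

theorem fx_roll {b : Bool} {h : L' → L} {p : L → L'} (hh : Monotone h) (hp : Monotone p) :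
    p (fx b (fun u => h (p u))) = fx b (fun A => p (h A)) := by
  symm
  have m : Monotone (fun A => p (h A)) := hp.comp hh
  have h1 : h (p (fx b (fun u => h (p u)))) = fx b (fun u => h (p u)) :=
    fx_fix (b := b) (G := fun u => h (p u)) (hh.comp hp)
  apply fx_unique m
  · show p (h (p (fx b (fun u => h (p u))))) = _
    rw [h1]
  · intro A hA
    have hA' : p (h A) = A := hA
    have h2 : leb b (fx b (fun u => h (p u))) (h A) := by
      apply fx_least; rw [hA']; exact leb_refl _ _
    have h3 := leb_mono hp h2
    rwa [hA'] at h3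

/-- Relations compatible with suprema and infima. -/
structure RelOK (Rel : L → L' → Prop) : Prop where
  sup : ∀ s : Set (L × L'), (∀ p ∈ s, Rel p.1 p.2) → Rel (sSup s).1 (sSup s).2
  inf : ∀ s : Set (L × L'), (∀ p ∈ s, Rel p.1 p.2) → Rel (sInf s).1 (sInf s).2

theorem fx_rel {Rel : L → L' → Prop} (hR : RelOK Rel) {b : Bool} {G : L → L} {G' : L' → L'}
    (hG : Monotone G) (hG' : Monotone G') (h : ∀ x y, Rel x y → Rel (G x) (G' y)) :
    Rel (fx b G) (fx b G') := by
  have hm : Monotone (fun p : L × L' => (G p.1, G' p.2)) := fun p q hpq => ⟨hG hpq.1, hG' hpq.2⟩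
  have e := fx_tri (b := b) (H := fun u _ => G u) (K := G') (fun _ _ _ _ h _ => hG h) hG'
  have key : Rel (fx b (fun p : L × L' => (G p.1, G' p.2))).1
      (fx b (fun p : L × L' => (G p.1, G' p.2))).2 := by
    cases b
    · exact OrderHom.gfp_induction (f := ⟨_, hm⟩) (p := fun p => Rel p.1 p.2)
        (fun a ha _ => h _ _ ha) (fun s hs => hR.inf s hs)
    · exact OrderHom.lfp_induction (f := ⟨_, hm⟩) (p := fun p => Rel p.1 p.2)
        (fun a ha _ => h _ _ ha) (fun s hs => hR.sup s hs)
  rw [e] at key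
  exact key

/-- Nested alternating fixed points. -/
def N : Bool → ℕ → ((ℕ → L) → L) → (ℕ → L) → L
  | _, 0, F, Y => F Y
  | b, n + 1, F, Y => fx b (fun X => N (!b) n F (Function.update Y n X))

theorem upd_mono {Y Y' : ℕ → L} {X X' : L} (n : ℕ) (h : Y ≤ Y') (hX : X ≤ X') :
    Function.update Y n X ≤ Function.update Y' n X' := by
  intro j
  by_cases hj : j = n
  · subst hj; simpa using hX
  · simpa [hj] using h j

theorem N_mono {F : (ℕ → L) → L} (hF : Monotone F) : ∀ (n : ℕ) (b : Bool), Monotone (N b n F)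
  | 0, _ => hF
  | n + 1, b => fun Y Y' h => fx_mono
      (fun _ _ hX => N_mono hF n (!b) (upd_mono n le_rfl hX))
      (fun X => N_mono hF n (!b) (upd_mono n h le_rfl))

theorem N_mono_up {F : (ℕ → L) → L} (hF : Monotone F) (n : ℕ) (b : Bool) (Y : ℕ → L) (m : ℕ) :
    Monotone (fun X => N b n F (Function.update Y m X)) :=
  fun _ _ hX => N_mono hF n b (upd_mono m le_rfl hX)

theorem N_unfold {F : (ℕ → L) → L} (hF : Monotone F) : ∀ (n : ℕ) (b : Bool) (Y : ℕ → L),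
    N b n F Y = F (fun j => if j < n then N b n F Y else Y j)
  | 0, _, Y => by simp [N]
  | n + 1, b, Y => by
      have h1 : N (!b) n F (Function.update Y n (N b (n+1) F Y)) = N b (n+1) F Y :=
        fx_fix (N_mono_up hF n (!b) Y n)
      have h2 := N_unfold hF n (!b) (Function.update Y n (N b (n+1) F Y))
      rw [h1] at h2
      conv_lhs => rw [h2]
      congr 1
      funext j
      by_cases hj : j < n
      · simp [hj, Nat.lt_succ_of_lt hj]
      · by_cases hj' : j = n
        · subst hj'; simp
        · have : ¬ j < n + 1 := by omega
          simp [hj, hj', this]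

theorem N_rel {Rel : L → L' → Prop} (hR : RelOK Rel) {F : (ℕ → L) → L} {F' : (ℕ → L') → L'}
    (hF : Monotone F) (hF' : Monotone F')
    (h : ∀ Y Y', (∀ j, Rel (Y j) (Y' j)) → Rel (F Y) (F' Y')) :
    ∀ (n : ℕ) (b : Bool) (Y : ℕ → L) (Y' : ℕ → L'), (∀ j, Rel (Y j) (Y' j)) →
      Rel (N b n F Y) (N b n F' Y')
  | 0, _, Y, Y', hY => h Y Y' hY
  | n + 1, b, Y, Y', hY => by
      apply fx_rel hR (N_mono_up hF _ _ _ _) (N_mono_up hF' _ _ _ _)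
      intro x y hxy
      apply N_rel hR hF hF' h
      intro j
      by_cases hj : j = n
      · subst hj; simpa using hxy
      · simpa [hj] using hY j

/-- Lower levels do not affect index `m`. -/
theorem N_congr {F F' : (ℕ → L) → L} {m : ℕ} {u : L} (h : ∀ Y, Y m = u → F Y = F' Y) :
    ∀ (n : ℕ) (b : Bool) (Y : ℕ → L), n ≤ m → Y m = u → N b n F Y = N b n F' Y
  | 0, _, Y, _, hY => h Y hY
  | n + 1, b, Y, hn, hY => by
      have : ∀ X, N (!b) n F (Function.update Y n X) = N (!b) n F' (Function.update Y n X) := by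
        intro X
        apply N_congr h n _ _ (by omega)
        rw [Function.update_of_ne (by omega)]; exact hY
      simp only [N, this]

theorem fx_const (b : Bool) (z : L) : fx b (fun _ => z) = z :=
  fx_unique monotone_const rfl (fun A hA => by rw [hA]; exact leb_refl _ _)

theorem N_shift {F : (ℕ → L) → L} : ∀ (n : ℕ) (b : Bool) (Y : ℕ → L),
    ∃ b', (n = 0 ∨ b' = b) ∧
    N b (n + 1) (fun Y => F (fun j => Y (j + 1))) Y = N b' n F (fun j => Y (j + 1))
  | 0, b, Y => ⟨b, Or.inl rfl, by
      have : ∀ X : L, (fun j => Function.update Y 0 X (j + 1)) = fun j => Y (j + 1) := by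
        intro X; funext j; simp
      simp only [N, this, fx_const]⟩
  | n + 1, b, Y => ⟨b, Or.inr rfl, by
      have key : ∀ X : L, N (!b) (n + 1) (fun Y => F (fun j => Y (j + 1)))
          (Function.update Y (n + 1) X) =
          N (!b) n F (Function.update (fun j => Y (j + 1)) n X) := by
        intro X
        obtain ⟨b', hb, h⟩ := N_shift (F := F) n (!b) (Function.update Y (n + 1) X)
        rw [h]
        have e : (fun j => Function.update Y (n + 1) X (j + 1)) =
            Function.update (fun j => Y (j + 1)) n X := by
          funext j
          by_cases hj : j = n
          · subst hj; simp
          · simp [hj]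
        rw [e]
        rcases hb with rfl | rfl
        · rfl
        · rfl
      show fx b _ = fx b _
      congr 1
      funext X
      exact key X⟩

theorem N_tri {Ff : (ℕ → L) → L' → L} {Fg : (ℕ → L') → L'}
    (hf : ∀ Y Y' v v', Y ≤ Y' → v ≤ v' → Ff Y v ≤ Ff Y' v') (hg : Monotone Fg) :
    ∀ (n : ℕ) (b : Bool) (Y : ℕ → L × L'),
      N b (n + 1) (fun Y => (Ff (fun j => (Y j).1) (Y 0).2, Fg (fun j => (Y j).2))) Y =
      (N b (n + 1) (fun Z => Ff Z (N b (n + 1) Fg (fun j => (Y j).2))) (fun j => (Y j).1),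
        N b (n + 1) Fg (fun j => (Y j).2)) := by
  have e1 : ∀ (Y : ℕ → L × L') (n : ℕ) (X : L × L'),
      (fun j => (Function.update Y n X j).1) = Function.update (fun j => (Y j).1) n X.1 := by
    intro Y n X; funext j
    by_cases hj : j = n
    · subst hj; simp
    · simp [hj]
  have e2 : ∀ (Y : ℕ → L × L') (n : ℕ) (X : L × L'),
      (fun j => (Function.update Y n X j).2) = Function.update (fun j => (Y j).2) n X.2 := by
    intro Y n X; funext j
    by_cases hj : j = n
    · subst hj; simp
    · simp [hj]
  have mf : ∀ v, Monotone (fun Z => Ff Z v) := fun v Y Y' h => hf _ _ _ _ h le_rfl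
  intro n
  induction n with
  | zero =>
    intro b Y
    simp only [N, e1, e2, Function.update_self]
    refine fx_tri (H := fun u v => Ff (Function.update (fun j => (Y j).1) 0 u) v)
      (K := fun v => Fg (Function.update (fun j => (Y j).2) 0 v)) ?_ ?_
    · intro u u' v v' hu hv
      exact hf _ _ _ _ (upd_mono 0 le_rfl hu) hv
    · intro v v' hv
      exact hg (upd_mono 0 le_rfl hv)
  | succ n ih =>
    intro b Y
    rw [N]
    simp only [ih, e1, e2]
    set K : L' → L' := fun v => N (!b) (n + 1) Fg (Function.update (fun j => (Y j).2) (n + 1) v)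
      with hK
    have mK : Monotone K := N_mono_up hg _ _ _ _
    have hfix : K (fx b K) = fx b K := fx_fix mK
    have t := fx_tri (b := b) (H := fun u v => N (!b) (n + 1) (fun Z => Ff Z (K v))
        (Function.update (fun j => (Y j).1) (n + 1) u)) (K := K) (by
          intro u u' v v' hu hv
          refine le_trans (N_mono_up (mf _) _ _ _ _ hu) ?_
          have : ∀ (m : ℕ) (b : Bool) (Z : ℕ → L),
              N b m (fun Z => Ff Z (K v)) Z ≤ N b m (fun Z => Ff Z (K v')) Z := by
            intro m
            induction m with
            | zero => intro b Z; exact hf _ _ _ _ le_rfl (mK hv)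
            | succ m ihm =>
              intro b Z
              exact fx_mono (N_mono_up (mf _) _ _ _ _) (fun x => ihm _ _)
          exact this _ _ _) mK
    refine t.trans ?_
    rw [hfix]
    rfl

end Fix

end AHS

namespace AHS

set_option linter.unusedVariables false

section Pts

variable {L L' : Type} [CompleteLattice L] [CompleteLattice L']

structure Pt (φ : L → Prop) : Prop where
  sup : ∀ s : Set L, φ (sSup s) ↔ ∃ x ∈ s, φ x
  inf : ∀ s : Set L, φ (sInf s) ↔ ∀ x ∈ s, φ x

theorem Pt_mem {A : Type} (a : A) : Pt (fun Z : Set A => a ∈ Z) :=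
  ⟨fun s => by simp, fun s => by simp⟩

theorem Pt.fst {φ : L → Prop} (h : Pt φ) : Pt (fun p : L × L' => φ p.1) :=
  ⟨fun s => by
    show φ (sSup s).1 ↔ _
    rw [Prod.fst_sSup, h.sup]; simp [Prod.exists],
   fun s => by
    show φ (sInf s).1 ↔ _
    rw [Prod.fst_sInf, h.inf]; simp [Prod.forall]⟩

theorem Pt.snd {φ : L' → Prop} (h : Pt φ) : Pt (fun p : L × L' => φ p.2) :=
  ⟨fun s => by
    show φ (sSup s).2 ↔ _
    rw [Prod.snd_sSup, h.sup]
    exact ⟨fun ⟨_, ⟨p, hp, e⟩, h⟩ => ⟨p, hp, by rw [e]; exact h⟩, fun ⟨p, hp, h⟩ => ⟨p.2, ⟨p, hp, rfl⟩, h⟩⟩,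
   fun s => by
    show φ (sInf s).2 ↔ _
    rw [Prod.snd_sInf, h.inf]
    exact ⟨fun h p hp => h _ ⟨p, hp, rfl⟩, fun h x ⟨p, hp, e⟩ => e ▸ h p hp⟩⟩

theorem RelOK_pt {I : Sort*} {φ : I → L → Prop} {ψ : I → L' → Prop}
    (hφ : ∀ i, Pt (φ i)) (hψ : ∀ i, Pt (ψ i)) :
    RelOK (fun x y => ∀ i, φ i x ↔ ψ i y) := by
  constructor
  · intro s hs i
    rw [((hφ i).fst (L' := L')).sup s, ((hψ i).snd (L := L)).sup s]
    exact exists_congr fun p => and_congr_right fun hp => hs p hp i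
  · intro s hs i
    rw [((hφ i).fst (L' := L')).inf s, ((hψ i).snd (L := L)).inf s]
    exact forall_congr' fun p => imp_congr_right fun hp => hs p hp i

end Pts

inductive Tr (Q : Type) : Type where
  | lit (b : Bool) (p : ℕ) : Tr Q
  | var (x : ℕ) : Tr Q
  | bin (b : Bool) (q1 q2 : Q) : Tr Q
  | mod (b : Bool) (i : Fin 2) (q : Q) : Tr Q

def Tr.map {Q Q' : Type} (f : Q → Q') : Tr Q → Tr Q'
  | .lit b p => .lit b p
  | .var x => .var x
  | .bin b q1 q2 => .bin b (f q1) (f q2)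
  | .mod b i q => .mod b i (f q)

def evalT {Q S : Type} (M : KModel (Fin 2) S) (env : ℕ → Set S) (T : Tr Q) (Z : Set (Q × S))
    (s : S) : Prop :=
  match T with
  | .lit b p => (s ∈ M.V p ↔ b = true)
  | .var x => s ∈ env x
  | .bin true q1 q2 => (q1, s) ∈ Z ∨ (q2, s) ∈ Z
  | .bin false q1 q2 => (q1, s) ∈ Z ∧ (q2, s) ∈ Z
  | .mod true i q => ∃ v, M.R i s v ∧ (q, v) ∈ Z
  | .mod false i q => ∀ v, M.R i s v → (q, v) ∈ Z

theorem evalT_mono {Q S : Type} (M : KModel (Fin 2) S) {env env' : ℕ → Set S} (T : Tr Q)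
    {Z Z' : Set (Q × S)} (he : env ≤ env') (hZ : Z ⊆ Z') (s : S) (h : evalT M env T Z s) :
    evalT M env' T Z' s := by
  rcases T with ⟨b, p⟩ | x | ⟨b, q1, q2⟩ | ⟨b, i, q⟩
  · exact h
  · exact he x h
  · cases b
    · exact ⟨hZ h.1, hZ h.2⟩
    · exact h.imp (fun h => hZ h) (fun h => hZ h)
  · cases b
    · exact fun v hv => hZ (h v hv)
    · exact h.imp fun v hv => ⟨hv.1, hZ hv.2⟩

/-- Relational invariance of transitions. -/
theorem evalT_map {Q Q' S : Type} (M : KModel (Fin 2) S) (env : ℕ → Set S) (f : Q → Q') (T : Tr Q)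
    {Z : Set (Q × S)} {Z' : Set (Q' × S)} (h : ∀ q s, (f q, s) ∈ Z' ↔ (q, s) ∈ Z) (s : S) :
    evalT M env (T.map f) Z' s ↔ evalT M env T Z s := by
  rcases T with ⟨b, p⟩ | x | ⟨b, q1, q2⟩ | ⟨b, i, q⟩
  · exact Iff.rfl
  · exact Iff.rfl
  · cases b <;> simp [evalT, Tr.map, h]
  · cases b <;> simp [evalT, Tr.map, h]

def stepF {Q S : Type} (M : KModel (Fin 2) S) (env : ℕ → Set S) (δ : Q → Tr Q) (Ω : Q → ℕ)
    (Y : ℕ → Set (Q × S)) : Set (Q × S) :=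
  {p | evalT M env (δ p.1) (Y (Ω p.1)) p.2}

theorem mem_stepF {Q S : Type} {M : KModel (Fin 2) S} {env : ℕ → Set S} {δ : Q → Tr Q} {Ω : Q → ℕ}
    {Y : ℕ → Set (Q × S)} {q : Q} {s : S} :
    (q, s) ∈ stepF M env δ Ω Y ↔ evalT M env (δ q) (Y (Ω q)) s := Iff.rfl

theorem stepF_mono2 {Q S : Type} (M : KModel (Fin 2) S) (δ : Q → Tr Q) (Ω : Q → ℕ)
    {env env' : ℕ → Set S} {Y Y' : ℕ → Set (Q × S)} (he : env ≤ env') (hY : Y ≤ Y') :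
    stepF M env δ Ω Y ≤ stepF M env' δ Ω Y' :=
  fun p hp => evalT_mono M _ he (hY _) _ hp

theorem stepF_mono {Q S : Type} (M : KModel (Fin 2) S) (env : ℕ → Set S) (δ : Q → Tr Q)
    (Ω : Q → ℕ) : Monotone (stepF M env δ Ω) :=
  fun _ _ h => stepF_mono2 M δ Ω le_rfl h

theorem N_step {Q S : Type} (M : KModel (Fin 2) S) (env : ℕ → Set S) (δ : Q → Tr Q)
    (Ω : Q → ℕ) (b : Bool) (n : ℕ) (hΩ : ∀ q, Ω q < n) (Y : ℕ → Set (Q × S)) (q : Q) (s : S) :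
    (q, s) ∈ N b n (stepF M env δ Ω) Y ↔
      evalT M env (δ q) (N b n (stepF M env δ Ω) Y) s := by
  conv_lhs => rw [N_unfold (stepF_mono M env δ Ω)]
  rw [mem_stepF]
  simp [hΩ q]

abbrev SF := ∀ S : Type, KModel (Fin 2) S → (ℕ → Set S) → Set S

def Rec (b : Bool) (n : ℕ) (f : SF) : Prop :=
  ∃ (Q : Type) (δ : Q → Tr Q) (Ω : Q → ℕ) (q0 : Q), (∀ q, Ω q < n) ∧
    ∀ (S : Type) (M : KModel (Fin 2) S) (env : ℕ → Set S) (Y : ℕ → Set (Q × S)) (s : S),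
      s ∈ f S M env ↔ (q0, s) ∈ N b n (stepF M env δ Ω) Y

theorem Rec.congr {b : Bool} {n : ℕ} {f g : SF} (h : Rec b n f)
    (e : ∀ S M env, f S M env = g S M env) : Rec b n g := by
  obtain ⟨Q, δ, Ω, q0, h1, h2⟩ := h
  exact ⟨Q, δ, Ω, q0, h1, fun S M env Y s => by rw [← e, h2]⟩

theorem Rec_lit (b : Bool) (n : ℕ) (c : Bool) (p : ℕ) :
    Rec b (n + 1) (fun S M env => {s | s ∈ M.V p ↔ c = true}) :=
  ⟨Unit, fun _ => .lit c p, fun _ => 0, (), fun _ => by simp, fun S M env Y s => by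
    rw [N_step _ _ _ _ _ _ (fun _ => by simp)]; rfl⟩

theorem Rec_var (b : Bool) (n : ℕ) (x : ℕ) : Rec b (n + 1) (fun S M env => env x) :=
  ⟨Unit, fun _ => .var x, fun _ => 0, (), fun _ => by simp, fun S M env Y s => by
    rw [N_step _ _ _ _ _ _ (fun _ => by simp)]; rfl⟩

def dTwo (T : Tr (Option Bool)) : Option Bool → Tr (Option Bool)
  | none => T
  | some false => .var 0
  | some true => .var 1

theorem Rec_bin (b : Bool) (n : ℕ) (c : Bool) :
    Rec b (n + 1) (fun S M env => if c then env 0 ∪ env 1 else env 0 ∩ env 1) :=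
  ⟨Option Bool, dTwo (.bin c (some false) (some true)), fun _ => 0, none, fun _ => by simp,
    fun S M env Y s => by
    rw [N_step _ _ _ _ _ _ (fun _ => by simp)]
    cases c <;> simp [dTwo, evalT, N_step]⟩

theorem Rec_mod (b : Bool) (n : ℕ) (c : Bool) (i : Fin 2) :
    Rec b (n + 1) (fun S M env => if c then {w | ∃ v, M.R i w v ∧ v ∈ env 0}
      else {w | ∀ v, M.R i w v → v ∈ env 0}) :=
  ⟨Option Bool, dTwo (.mod c i (some false)), fun _ => 0, none, fun _ => by simp,
    fun S M env Y s => by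
    rw [N_step _ _ _ _ _ _ (fun _ => by simp)]
    cases c <;> simp [dTwo, evalT, N_step]⟩

/-- Substitution automaton. -/
def subTr {Q : Type} {Qg : ℕ → Type} (q0 : ∀ x, Qg x) :
    Tr Q → Tr (Q ⊕ (Σ x, Qg x))
  | .lit b p => .lit b p
  | .var x => .bin true (.inr ⟨x, q0 x⟩) (.inr ⟨x, q0 x⟩)
  | .bin b q1 q2 => .bin b (.inl q1) (.inl q2)
  | .mod b i q => .mod b i (.inl q)

def subΩ {Q : Type} (k : ℕ) : Tr Q → ℕ
  | .var _ => 0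
  | _ => k

def subΔ {Q : Type} {Qg : ℕ → Type} (q0 : ∀ x, Qg x) (δ : Q → Tr Q) (δg : ∀ x, Qg x → Tr (Qg x)) :
    Q ⊕ (Σ x, Qg x) → Tr (Q ⊕ (Σ x, Qg x))
  | .inl q => subTr q0 (δ q)
  | .inr y => (δg y.1 y.2).map (fun q => .inr ⟨y.1, q⟩)

def subO {Q : Type} {Qg : ℕ → Type} (δ : Q → Tr Q) (Ω : Q → ℕ) (Ωg : ∀ x, Qg x → ℕ) :
    Q ⊕ (Σ x, Qg x) → ℕ
  | .inl q => subΩ (Ω q) (δ q)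
  | .inr y => Ωg y.1 y.2

theorem Rec_sub {b : Bool} {n : ℕ} {f : SF} {g : ℕ → SF} (hf : Rec b (n + 1) f)
    (hg : ∀ x, Rec b (n + 1) (g x)) :
    Rec b (n + 1) (fun S M env => f S M (fun x => g x S M env)) := by
  obtain ⟨Q, δ, Ω, q0, hΩ, hf⟩ := hf
  choose Qg δg Ωg q0g hΩg hg using hg
  refine ⟨Q ⊕ (Σ x, Qg x), subΔ q0g δ δg, subO δ Ω Ωg, .inl q0, ?_, ?_⟩
  · rintro (q | ⟨x, q⟩)
    · have := hΩ q
      simp only [subO]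
      cases δ q <;> simp [subΩ] <;> omega
    · exact hΩg x q
  intro S M env Y s
  let δG : (Σ x, Qg x) → Tr (Σ x, Qg x) := fun y => (δg y.1 y.2).map (fun q => ⟨y.1, q⟩)
  let ΩG : (Σ x, Qg x) → ℕ := fun y => Ωg y.1 y.2
  let eo : Set ((Σ x, Qg x) × S) → ℕ → Set S := fun v x => {s | ((⟨x, q0g x⟩ : Σ x, Qg x), s) ∈ v}
  let Ff : (ℕ → Set (Q × S)) → Set ((Σ x, Qg x) × S) → Set (Q × S) :=
    fun Y v => stepF M (eo v) δ Ω Y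
  let Fg : (ℕ → Set ((Σ x, Qg x) × S)) → Set ((Σ x, Qg x) × S) := stepF M env δG ΩG
  have mf : ∀ Y Y' v v', Y ≤ Y' → v ≤ v' → Ff Y v ≤ Ff Y' v' := by
    intro Y Y' v v' hY hv
    exact stepF_mono2 M δ Ω (fun x s hs => hv hs) hY
  have mg : Monotone Fg := stepF_mono _ _ _ _
  let Y' : ℕ → Set (Q × S) × Set ((Σ x, Qg x) × S) :=
    fun j => ({p | (.inl p.1, p.2) ∈ Y j}, {p | (.inr p.1, p.2) ∈ Y j})
  let φ : ((Q × S) ⊕ ((Σ x, Qg x) × S)) → Set ((Q ⊕ (Σ x, Qg x)) × S) → Prop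
    | .inl p => fun Z => (.inl p.1, p.2) ∈ Z
    | .inr p => fun Z => (.inr p.1, p.2) ∈ Z
  let ψ : ((Q × S) ⊕ ((Σ x, Qg x) × S)) → (Set (Q × S) × Set ((Σ x, Qg x) × S)) → Prop
    | .inl p => fun Z => p ∈ Z.1
    | .inr p => fun Z => p ∈ Z.2
  have hR := RelOK_pt (φ := φ) (ψ := ψ)
    (by rintro (p | p) <;> exact Pt_mem _)
    (by rintro (p | p)
        · exact (Pt_mem p).fst
        · exact (Pt_mem p).snd)
  have key := N_rel hR (F := stepF M env (subΔ q0g δ δg) (subO δ Ω Ωg))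
    (F' := fun Y => (Ff (fun j => (Y j).1) (Y 0).2, Fg (fun j => (Y j).2)))
    (stepF_mono _ _ _ _)
    (fun Y Y' h => ⟨mf _ _ _ _ (fun j => (h j).1) (h 0).2, mg (fun j => (h j).2)⟩)
    (by
      intro Z Z' hZ
      have h1 : ∀ j q s, (Sum.inl q, s) ∈ Z j ↔ (q, s) ∈ (Z' j).1 := fun j q s => hZ j (.inl (q, s))
      have h2 : ∀ j y s, (Sum.inr y, s) ∈ Z j ↔ (y, s) ∈ (Z' j).2 := fun j q s => hZ j (.inr (q, s))
      rintro (⟨q, s⟩ | ⟨y, s⟩)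
      · show evalT M env (subTr q0g (δ q)) (Z (subΩ (Ω q) (δ q))) s ↔
          evalT M (eo (Z' 0).2) (δ q) ((Z' (Ω q)).1) s
        rcases δ q with ⟨b, p⟩ | x | ⟨b, q1, q2⟩ | ⟨b, i, q⟩
        · exact Iff.rfl
        · simp [subTr, subΩ, evalT, eo, h2]
        · cases b <;> simp [subTr, subΩ, evalT, h1]
        · cases b <;> simp [subTr, subΩ, evalT, h1]
      · show evalT M env ((δg y.1 y.2).map (fun q => .inr ⟨y.1, q⟩)) (Z (Ωg y.1 y.2)) s ↔
          evalT M env ((δg y.1 y.2).map (fun q => ⟨y.1, q⟩)) ((Z' (Ωg y.1 y.2)).2) s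
        refine Iff.trans ?_ (evalT_map M env (fun q => (⟨y.1, q⟩ : Σ x, Qg x)) (δg y.1 y.2)
          (Z := {p | ((⟨y.1, p.1⟩ : Σ x, Qg x), p.2) ∈ (Z' (Ωg y.1 y.2)).2})
          (Z' := (Z' (Ωg y.1 y.2)).2) (fun q s => Iff.rfl) s).symm
        exact evalT_map M env _ (δg y.1 y.2) (fun q s => h2 _ _ _) s)
    (n + 1) b Y Y' (by rintro j (p | p) <;> exact Iff.rfl) (.inl (q0, s))
  rw [N_tri mf mg] at key
  have ee : eo (N b (n + 1) Fg (fun j => (Y' j).2)) = fun x => g x S M env := by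
    funext x
    ext s
    rw [hg x S M env (fun j => {p | (⟨x, p.1⟩, p.2) ∈ (Y' j).2}) s]
    have hR' := RelOK_pt (φ := fun (p : Qg x × S) (Z : Set ((Σ x, Qg x) × S)) =>
      ((⟨x, p.1⟩ : Σ x, Qg x), p.2) ∈ Z)
      (ψ := fun (p : Qg x × S) (Z : Set (Qg x × S)) => p ∈ Z)
      (fun p => Pt_mem _) (fun p => Pt_mem _)
    exact N_rel hR' (F := Fg) (F' := stepF M env (δg x) (Ωg x)) mg (stepF_mono _ _ _ _) (by
      rintro Z Z' hZ ⟨q, s⟩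
      exact evalT_map M env _ (δg x q) (fun q s => hZ _ (q, s)) s) (n + 1) b _ _
      (fun j p => Iff.rfl) (q0g x, s)
  refine Iff.trans ?_ key.symm
  show _ ↔ (q0, s) ∈ N b (n + 1) (fun Z => stepF M (eo (N b (n + 1) Fg (fun j => (Y' j).2))) δ Ω Z) _
  rw [ee]
  exact hf S M _ _ s

open Classical in
theorem Rec_fx {b : Bool} {n : ℕ} {f : SF} (X : ℕ) (hf : Rec b (n + 1) f) :
    Rec b (n + 1) (fun S M env => fx b (fun A => f S M (Function.update env X A))) := by
  obtain ⟨Q, δ, Ω, q0, hΩ, hf⟩ := hf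
  refine ⟨Q, fun q => if δ q = .var X then .bin true q0 q0 else δ q,
    fun q => if δ q = .var X then n else Ω q, q0, ?_, ?_⟩
  · intro q
    have := hΩ q
    dsimp only
    split_ifs <;> omega
  intro S M env Y s
  let p : Set (Q × S) → Set S := fun U => {s | (q0, s) ∈ U}
  let G : Set S → (ℕ → Set (Q × S)) → Set (Q × S) :=
    fun A => stepF M (Function.update env X A) δ Ω
  have mG : ∀ A, Monotone (G A) := fun A => stepF_mono _ _ _ _
  have mG2 : ∀ A A' Y, A ≤ A' → G A Y ≤ G A' Y := fun A A' Y h =>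
    stepF_mono2 M δ Ω (upd_mono X le_rfl h) le_rfl
  have mN : ∀ (A A' : Set S), A ≤ A' → ∀ (m : ℕ) (b : Bool) Y, N b m (G A) Y ≤ N b m (G A') Y := by
    intro A A' h m
    induction m with
    | zero => intro b Y; exact mG2 _ _ _ h
    | succ m ih => intro b Y; exact fx_mono (N_mono_up (mG _) _ _ _ _) (fun x => ih _ _)
  have e1 : N b (n + 1) (stepF M env (fun q => if δ q = .var X then .bin true q0 q0 else δ q)
      (fun q => if δ q = .var X then n else Ω q)) Y =
      fx b (fun U => N (!b) n (G (p U)) (Function.update Y n U)) := by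
    rw [N]
    congr 1
    funext U
    refine N_congr (m := n) (u := U) ?_ n (!b) _ le_rfl (by simp)
    rintro Z rfl
    ext ⟨q, s⟩
    rw [mem_stepF]
    show _ ↔ evalT M (Function.update env X (p (Z n))) (δ q) (Z (Ω q)) s
    by_cases hq : δ q = .var X
    · simp [hq, evalT, p]
    · simp only [hq, if_false]
      rcases hδ : δ q with ⟨b, p⟩ | x | ⟨b, q1, q2⟩ | ⟨b, i, q⟩
      · exact Iff.rfl
      · have : x ≠ X := by rintro rfl; exact hq hδ
        simp [evalT, this]
      · cases b <;> exact Iff.rfl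
      · cases b <;> exact Iff.rfl
  have mp : Monotone p := fun U U' h s hs => h hs
  rw [e1, fx_diag (G := fun U V => N (!b) n (G (p U)) (Function.update Y n V)) (by
    intro u u' v v' hu hv
    exact le_trans (N_mono_up (mG _) n (!b) Y n hv) (mN _ _ (mp hu) _ _ _))]
  show _ ↔ s ∈ p (fx b (fun U => N b (n + 1) (G (p U)) Y))
  rw [fx_roll (h := fun A => N b (n + 1) (G A) Y) (fun A A' h => mN _ _ h _ _ _) mp]
  have : (fun A => f S M (Function.update env X A)) = fun A => p (N b (n + 1) (G A) Y) := by
    funext A; ext s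
    exact hf S M _ Y s
  show s ∈ fx b (fun A => f S M (Function.update env X A)) ↔ _
  rw [this]

theorem Rec_up {b : Bool} {n : ℕ} {f : SF} (hf : Rec b (n + 1) f) : Rec b (n + 2) f := by
  obtain ⟨Q, δ, Ω, q0, hΩ, hf⟩ := hf
  refine ⟨Q, δ, fun q => Ω q + 1, q0, fun q => Nat.succ_lt_succ (hΩ q), ?_⟩
  intro S M env Y s
  obtain ⟨b', hb, h⟩ := N_shift (F := stepF M env δ Ω) (n + 1) b Y
  have hb : b' = b := by rcases hb with h | h; · omega
                         · exact h
  subst hb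
  have h' : N b' (n + 2) (stepF M env δ fun q => Ω q + 1) Y = _ := h
  rw [h', hf]

theorem Rec_flip {b : Bool} {n : ℕ} {f : SF} (hf : Rec b n f) : Rec (!b) (n + 1) f := by
  obtain ⟨Q, δ, Ω, q0, hΩ, hf⟩ := hf
  refine ⟨Q, δ, Ω, q0, fun q => by have := hΩ q; omega, ?_⟩
  intro S M env Y s
  rw [N, ← fx_fix (N_mono_up (stepF_mono _ _ _ _) _ _ _ _), Bool.not_not]
  exact hf _ _ _ _ _

end AHS

namespace AHS

set_option linter.unusedVariables false

open MuForm

theorem sem_congr {S : Type} (M : KModel (Fin 2) S) : ∀ (φ : MuForm (Fin 2)) (env env' : ℕ → Set S),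
    (∀ x ∈ freeVars φ, env x = env' x) → sem M env φ = sem M env' φ
  | .prop p, _, _, _ => rfl
  | .nprop p, _, _, _ => rfl
  | .var x, env, env', h => h x rfl
  | .and a b, env, env', h => by
      simp only [sem]
      rw [sem_congr M a env env' fun x hx => h x (Or.inl hx),
        sem_congr M b env env' fun x hx => h x (Or.inr hx)]
  | .or a b, env, env', h => by
      simp only [sem]
      rw [sem_congr M a env env' fun x hx => h x (Or.inl hx),
        sem_congr M b env env' fun x hx => h x (Or.inr hx)]
  | .box i a, env, env', h => by
      simp only [sem]
      rw [sem_congr M a env env' h]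
  | .dia i a, env, env', h => by
      simp only [sem]
      rw [sem_congr M a env env' h]
  | .mu y a, env, env', h => by
      have : ∀ A, sem M (Function.update env y A) a = sem M (Function.update env' y A) a := by
        intro A
        apply sem_congr M a
        intro x hx
        by_cases hxy : x = y
        · subst hxy; simp
        · simpa [hxy] using h x ⟨hx, hxy⟩
      simp only [sem, this]
  | .nu y a, env, env', h => by
      have : ∀ A, sem M (Function.update env y A) a = sem M (Function.update env' y A) a := by
        intro A
        apply sem_congr M a
        intro x hx
        by_cases hxy : x = y
        · subst hxy; simp
        · simpa [hxy] using h x ⟨hx, hxy⟩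
      simp only [sem, this]

theorem subst_aux {S : Type} (M : KModel (Fin 2) S) (X : ℕ) (ψ a : MuForm (Fin 2)) (y : ℕ)
    (hy : y ≠ X) (h1 : X ∈ freeVars a → y ∉ freeVars ψ) (env : ℕ → Set S) (A : Set S) :
    sem M (Function.update (Function.update env y A) X (sem M (Function.update env y A) ψ)) a =
    sem M (Function.update (Function.update env X (sem M env ψ)) y A) a := by
  apply sem_congr
  intro x hx
  by_cases hxX : x = X
  · subst hxX
    have : sem M (Function.update env y A) ψ = sem M env ψ := by
      apply sem_congr
      intro z hz
      have : z ≠ y := by rintro rfl; exact h1 hx hz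
      simp [this]
    simp [this, hy.symm]
  · by_cases hxy : x = y
    · subst hxy; simp [hxX]
    · simp [hxX, hxy]

theorem sem_subst {S : Type} (M : KModel (Fin 2) S) (X : ℕ) (ψ : MuForm (Fin 2)) :
    ∀ (φ : MuForm (Fin 2)) (env : ℕ → Set S), CaptureFree X ψ φ →
    sem M env (subst X ψ φ) = sem M (Function.update env X (sem M env ψ)) φ
  | .prop p, _, _ => rfl
  | .nprop p, _, _ => rfl
  | .var x, env, h => by
      by_cases hx : x = X
      · subst hx; simp [subst, sem]
      · simp [subst, sem, hx]
  | .and a b, env, h => by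
      simp only [sem, subst]
      rw [sem_subst M X ψ a env h.1, sem_subst M X ψ b env h.2]
  | .or a b, env, h => by
      simp only [sem, subst]
      rw [sem_subst M X ψ a env h.1, sem_subst M X ψ b env h.2]
  | .box i a, env, h => by
      simp only [sem, subst]
      rw [sem_subst M X ψ a env h]
  | .dia i a, env, h => by
      simp only [sem, subst]
      rw [sem_subst M X ψ a env h]
  | .mu y a, env, h => by
      by_cases hy : y = X
      · subst hy
        simp [subst, sem]
      · obtain ⟨h1, h2⟩ := h.resolve_left hy
        have : ∀ A, sem M (Function.update env y A) (subst X ψ a) =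
            sem M (Function.update (Function.update env X (sem M env ψ)) y A) a := by
          intro A
          rw [sem_subst M X ψ a _ h2, subst_aux M X ψ a y hy h1]
        simp only [subst, hy, if_false, sem, this]
  | .nu y a, env, h => by
      by_cases hy : y = X
      · subst hy
        simp [subst, sem]
      · obtain ⟨h1, h2⟩ := h.resolve_left hy
        have : ∀ A, sem M (Function.update env y A) (subst X ψ a) =
            sem M (Function.update (Function.update env X (sem M env ψ)) y A) a := by
          intro A
          rw [sem_subst M X ψ a _ h2, subst_aux M X ψ a y hy h1]
        simp only [subst, hy, if_false, sem, this]

def sf (φ : MuForm (Fin 2)) : SF := fun S M env => sem M env φ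

theorem Rec_and {b n} {φ ψ : MuForm (Fin 2)} (h1 : Rec b (n + 1) (sf φ)) (h2 : Rec b (n + 1) (sf ψ)) :
    Rec b (n + 1) (sf (.and φ ψ)) :=
  (Rec_sub (g := fun x => if x = 0 then sf φ else sf ψ) (Rec_bin b n false)
    (fun x => by split_ifs <;> assumption)).congr (fun S M env => by simp [sf, sem])

theorem Rec_or {b n} {φ ψ : MuForm (Fin 2)} (h1 : Rec b (n + 1) (sf φ)) (h2 : Rec b (n + 1) (sf ψ)) :
    Rec b (n + 1) (sf (.or φ ψ)) :=
  (Rec_sub (g := fun x => if x = 0 then sf φ else sf ψ) (Rec_bin b n true)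
    (fun x => by split_ifs <;> assumption)).congr (fun S M env => by simp [sf, sem])

theorem Rec_box {b n i} {φ : MuForm (Fin 2)} (h1 : Rec b (n + 1) (sf φ)) :
    Rec b (n + 1) (sf (.box i φ)) :=
  (Rec_sub (g := fun x => sf φ) (Rec_mod b n false i)
    (fun x => h1)).congr (fun S M env => by simp [sf, sem])

theorem Rec_dia {b n i} {φ : MuForm (Fin 2)} (h1 : Rec b (n + 1) (sf φ)) :
    Rec b (n + 1) (sf (.dia i φ)) :=
  (Rec_sub (g := fun x => sf φ) (Rec_mod b n true i)
    (fun x => h1)).congr (fun S M env => by simp [sf, sem])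

theorem Rec_subst {b n X} {φ ψ : MuForm (Fin 2)} (h1 : Rec b (n + 1) (sf φ))
    (h2 : Rec b (n + 1) (sf ψ)) (hc : CaptureFree X ψ φ) :
    Rec b (n + 1) (sf (subst X ψ φ)) :=
  (Rec_sub (g := fun x => if x = X then sf ψ else fun S M env => env x) h1
    (fun x => by
      split_ifs
      · assumption
      · exact Rec_var b n x)).congr (fun S M env => by
      simp only [sf]
      rw [sem_subst M X ψ φ env hc]
      congr 1
      funext x
      by_cases hx : x = X
      · subst hx; simp [sf]
      · simp [hx])

theorem Rec_noFix (b : Bool) : ∀ φ : MuForm (Fin 2), φ.noFix → Rec b 1 (sf φ)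
  | .prop p, _ => (Rec_lit b 0 true p).congr (fun S M env => by simp [sf, sem])
  | .nprop p, _ => (Rec_lit b 0 false p).congr (fun S M env => by
      ext s; simp [sf, sem])
  | .var x, _ => Rec_var b 0 x
  | .and a c, h => Rec_and (Rec_noFix b a h.1) (Rec_noFix b c h.2)
  | .or a c, h => Rec_or (Rec_noFix b a h.1) (Rec_noFix b c h.2)
  | .box i a, h => Rec_box (Rec_noFix b a h)
  | .dia i a, h => Rec_dia (Rec_noFix b a h)
  | .mu x a, h => h.elim
  | .nu x a, h => h.elim

def HypR (b : Bool) : ℕ → MuForm (Fin 2) → Prop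
  | 0, φ => φ.noFix
  | n + 1, φ => Rec b (n + 1) (sf φ)

theorem HypR_up {b n} {φ : MuForm (Fin 2)} (h : HypR b n φ) : HypR b (n + 1) φ := by
  cases n with
  | zero => exact Rec_noFix b φ h
  | succ n => exact Rec_up h

theorem HypR_flip {b n} {φ : MuForm (Fin 2)} (h : HypR (!b) n φ) : HypR b (n + 1) φ := by
  cases n with
  | zero => exact Rec_noFix b φ h
  | succ n => have := Rec_flip h; rwa [Bool.not_not] at this

theorem sigma_rec {n : ℕ} {φ : MuForm (Fin 2)} (h : SigmaMu n φ) : HypR true n φ := by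
  refine SigmaMu.rec (motive_1 := fun n φ _ => HypR true n φ) (motive_2 := fun n φ _ => HypR false n φ)
    ?_ ?_ ?_ ?_ ?_ ?_ ?_ ?_ ?_ ?_ ?_ ?_ ?_ ?_ ?_ ?_ ?_ ?_ h
  · intro φ h; exact h
  · intro n φ _ h; exact HypR_up h
  · intro n φ _ h; exact HypR_flip h
  · intro n a b _ _ h1 h2; exact Rec_and h1 h2
  · intro n a b _ _ h1 h2; exact Rec_or h1 h2
  · intro n i a _ h; exact Rec_box h
  · intro n i a _ h; exact Rec_dia h
  · intro n X a _ h; exact Rec_fx X h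
  · intro n X a ψ _ _ hc h1 h2; exact Rec_subst h1 h2 hc
  · intro φ h; exact h
  · intro n φ _ h; exact HypR_flip h
  · intro n φ _ h; exact HypR_up h
  · intro n a b _ _ h1 h2; exact Rec_and h1 h2
  · intro n a b _ _ h1 h2; exact Rec_or h1 h2
  · intro n i a _ h; exact Rec_box h
  · intro n i a _ h; exact Rec_dia h
  · intro n X a _ h; exact Rec_fx X h
  · intro n X a ψ _ _ hc h1 h2; exact Rec_subst h1 h2 hc

/-- Adding a start state whose transition is a trivial binary one. -/
theorem Rec_start {b : Bool} {n : ℕ} {f : SF} (hf : Rec b (n + 1) f) :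
    ∃ (Q : Type) (δ : Q → Tr Q) (Ω : Q → ℕ) (q0 q1 q2 : Q), (∀ q, Ω q < n + 1) ∧
      δ q0 = .bin true q1 q2 ∧
    ∀ (S : Type) (M : KModel (Fin 2) S) (env : ℕ → Set S) (Y : ℕ → Set (Q × S)) (s : S),
      s ∈ f S M env ↔ (q0, s) ∈ N b (n + 1) (stepF M env δ Ω) Y := by
  obtain ⟨Q, δ, Ω, q0, hΩ, hf⟩ := hf
  let δ' : Option Q → Tr (Option Q)
    | none => .bin true (some q0) (some q0)
    | some q => (δ q).map some
  let Ω' : Option Q → ℕ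
    | none => 0
    | some q => Ω q
  have hΩ' : ∀ q, Ω' q < n + 1 := by
    rintro (_ | q)
    · exact Nat.succ_pos n
    · exact hΩ q
  refine ⟨Option Q, δ', Ω', none, some q0, some q0, hΩ', rfl, ?_⟩
  intro S M env Y s
  rw [N_step _ _ _ _ _ _ hΩ']
  have hR' := RelOK_pt (φ := fun (p : Q × S) (Z : Set (Option Q × S)) => (some p.1, p.2) ∈ Z)
      (ψ := fun (p : Q × S) (Z : Set (Q × S)) => p ∈ Z)
      (fun p => Pt_mem _) (fun p => Pt_mem _)
  have key := N_rel hR' (F := stepF M env δ' Ω') (F' := stepF M env δ Ω) (stepF_mono _ _ _ _)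
    (stepF_mono _ _ _ _) (by
      rintro Z Z' hZ ⟨q, s⟩
      exact evalT_map M env _ (δ q) (fun q s => hZ _ (q, s)) s) (n + 1) b Y
      (fun j => {p | (some p.1, p.2) ∈ Y j}) (fun j p => Iff.rfl) (q0, s)
  show _ ↔ _ ∨ _
  rw [or_self, key]
  exact hf _ _ _ _ _

/- ### bnd and dual -/

def bnd : Bool → ℕ → MuForm (Fin 2) → MuForm (Fin 2)
  | _, 0, θ => θ
  | true, n + 1, θ => .mu n (bnd false n θ)
  | false, n + 1, θ => .nu n (bnd true n θ)

theorem sem_bnd {S : Type} (M : KModel (Fin 2) S) (θ : MuForm (Fin 2)) :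
    ∀ (n : ℕ) (b : Bool) (env : ℕ → Set S), sem M env (bnd b n θ) = N b n (fun Y => sem M Y θ) env
  | 0, _, _ => by simp [bnd, N]
  | n + 1, true, env => by
      simp only [bnd, sem, sem_bnd M θ n, N]; rfl
  | n + 1, false, env => by
      simp only [bnd, sem, sem_bnd M θ n, N]; rfl

theorem bnd_class {θ : MuForm (Fin 2)} (h : θ.noFix) : ∀ n,
    SigmaMu n (bnd true n θ) ∧ PiMu n (bnd false n θ)
  | 0 => ⟨.base h, .base h⟩
  | n + 1 => ⟨.muI (.upP (bnd_class h n).2), .nuI (.upS (bnd_class h n).1)⟩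

def dual : MuForm (Fin 2) → MuForm (Fin 2)
  | .prop p => .nprop p
  | .nprop p => .prop p
  | .var x => .var x
  | .and a b => .or (dual a) (dual b)
  | .or a b => .and (dual a) (dual b)
  | .box i a => .dia i (dual a)
  | .dia i a => .box i (dual a)
  | .mu x a => .nu x (dual a)
  | .nu x a => .mu x (dual a)

theorem compl_upd {S : Type} (env : ℕ → Set S) (x : ℕ) (A : Set S) :
    (fun y => (Function.update env x A y)ᶜ) = Function.update (fun y => (env y)ᶜ) x Aᶜ := by
  funext y
  by_cases h : y = x
  · subst h; simp
  · simp [h]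

theorem sem_dual {S : Type} (M : KModel (Fin 2) S) : ∀ (φ : MuForm (Fin 2)) (env : ℕ → Set S),
    sem M (fun x => (env x)ᶜ) (dual φ) = (sem M env φ)ᶜ
  | .prop p, _ => rfl
  | .nprop p, _ => by simp [dual, sem]
  | .var x, env => rfl
  | .and a b, env => by simp only [dual, sem, sem_dual M a, sem_dual M b, Set.compl_inter]
  | .or a b, env => by simp only [dual, sem, sem_dual M a, sem_dual M b, Set.compl_union]
  | .box i a, env => by
      ext s; simp [dual, sem, sem_dual M a]
  | .dia i a, env => by
      ext s; simp [dual, sem, sem_dual M a]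
  | .mu x a, env => by
      have h : ∀ A, sem M (Function.update (fun y => (env y)ᶜ) x A) (dual a) =
          (sem M (Function.update env x Aᶜ) a)ᶜ := by
        intro A
        rw [← sem_dual M a, compl_upd, compl_compl]
      simp only [dual, sem, h]
      ext s
      simp only [Set.sSup_eq_sUnion, Set.sInf_eq_sInter, Set.mem_sUnion, Set.mem_compl_iff,
        Set.mem_sInter, Set.mem_ofPred_eq, not_forall]
      constructor
      · rintro ⟨A, hA, hs⟩
        exact ⟨Aᶜ, by rw [Set.subset_compl_comm]; exact hA, by simpa using hs⟩
      · rintro ⟨A, hA, hs⟩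
        exact ⟨Aᶜ, by rw [compl_compl, Set.compl_subset_compl]; exact hA, hs⟩
  | .nu x a, env => by
      have h : ∀ A, sem M (Function.update (fun y => (env y)ᶜ) x A) (dual a) =
          (sem M (Function.update env x Aᶜ) a)ᶜ := by
        intro A
        rw [← sem_dual M a, compl_upd, compl_compl]
      simp only [dual, sem, h]
      ext s
      simp only [Set.sSup_eq_sUnion, Set.sInf_eq_sInter, Set.mem_sUnion, Set.mem_compl_iff,
        Set.mem_sInter, Set.mem_ofPred_eq, not_exists, not_and]
      constructor
      · intro hh A hA hs
        exact hh Aᶜ (by rw [compl_compl, Set.compl_subset_compl]; exact hA) hs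
      · intro hh A hA
        by_contra hs
        exact hh Aᶜ (Set.compl_subset_comm.mp hA) hs

theorem dual_bnd (θ : MuForm (Fin 2)) : ∀ n b, dual (bnd b n θ) = bnd (!b) n (dual θ)
  | 0, _ => by simp [bnd]
  | n + 1, true => by simp [bnd, dual, dual_bnd θ n]
  | n + 1, false => by simp [bnd, dual, dual_bnd θ n]

theorem noFix_dual : ∀ θ : MuForm (Fin 2), θ.noFix → (dual θ).noFix
  | .prop p, _ => trivial
  | .nprop p, _ => trivial
  | .var x, _ => trivial
  | .and a b, h => ⟨noFix_dual a h.1, noFix_dual b h.2⟩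
  | .or a b, h => ⟨noFix_dual a h.1, noFix_dual b h.2⟩
  | .box i a, h => noFix_dual a h
  | .dia i a, h => noFix_dual a h
  | .mu x a, h => h.elim
  | .nu x a, h => h.elim

/-- Abstract diagonalisation. -/
theorem diag_main (C0 C1 : Set (Frame Unit)) (n : ℕ) (θ : MuForm (Fin 2)) (hθ : θ.noFix)
    (H : ∀ f : SF, Rec true (n + 1) f → ∃ F ∈ fusion2 C0 C1, ∃ (V : ℕ → Set F.World) (r : F.World),
      ∀ env, r ∈ sem ⟨F.R, V⟩ env (bnd true (n + 1) θ) ↔ r ∈ f F.World ⟨F.R, V⟩ (fun _ => ∅)) :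
    ∃ φ : MuForm (Fin 2), (SigmaMu (n + 1) φ ∨ PiMu (n + 1) φ) ∧
      ∀ ψ : MuForm (Fin 2), (SigmaMu n ψ ∨ PiMu n ψ) → ¬ EquivOver (fusion2 C0 C1) φ ψ := by
  refine ⟨dual (bnd true (n + 1) θ), Or.inr ?_, ?_⟩
  · rw [dual_bnd]; exact (bnd_class (noFix_dual θ hθ) (n + 1)).2
  · intro ψ hψ he
    have hs : SigmaMu (n + 1) ψ := hψ.elim .upS .upP
    obtain ⟨F, hF, V, r, hr⟩ := H _ (sigma_rec hs)
    have h1 := he F hF V (fun _ => ∅)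
    have h2 := sem_dual (S := F.World) ⟨F.R, V⟩ (bnd true (n + 1) θ) (fun _ => Set.univ)
    simp only [Set.compl_univ] at h2
    rw [h2] at h1
    have h3 := hr (fun _ => Set.univ)
    rw [sf, ← h1] at h3
    exact (iff_not_self h3)

end AHS

namespace AHS

set_option linter.unusedVariables false

theorem mem_of_bij {C : Set (Frame Unit)} (hiso : ClosedUnderIso C) (hdu : ClosedUnderDU C)
    (F : Frame Unit) (hF : F ∈ C) {W J : Type} (cp : W → J) (ty : W → F.World)
    (R : W → W → Prop) (hR : ∀ a b, R a b ↔ cp a = cp b ∧ F.R () (ty a) (ty b))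
    (hinj : ∀ a b, cp a = cp b → ty a = ty b → a = b)
    (hsurj : ∀ a t, ∃ b, cp b = cp a ∧ ty b = t) :
    (⟨W, fun _ => R⟩ : Frame Unit) ∈ C := by
  let I : Type := {j : J // ∃ a, cp a = j}
  have h1 := hdu I (fun _ => F) (fun _ => hF)
  let e : (Σ _ : I, F.World) ≃ W := Equiv.symm (Equiv.ofBijective
    (fun a => (⟨⟨cp a, a, rfl⟩, ty a⟩ : Σ _ : I, F.World)) (by
      constructor
      · intro a b h
        simp only [Sigma.mk.injEq, Subtype.mk.injEq, heq_eq_eq, I] at h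
        exact hinj a b h.1 h.2
      · rintro ⟨⟨j, a, rfl⟩, t⟩
        obtain ⟨b, hb1, hb2⟩ := hsurj a t
        exact ⟨b, by simp [hb1, hb2]⟩))
  refine hiso _ h1 _ ⟨e, ?_⟩
  intro i w v
  obtain ⟨a, rfl⟩ := e.symm.surjective w
  obtain ⟨b, rfl⟩ := e.symm.surjective v
  have e1 : e (e.symm a) = a := e.apply_symm_apply a
  have e2 : e (e.symm b) = b := e.apply_symm_apply b
  show _ ↔ R (e (e.symm a)) (e (e.symm b))
  rw [e1, e2, hR]
  have ea : e.symm a = ⟨⟨cp a, a, rfl⟩, ty a⟩ := rfl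
  have eb : e.symm b = ⟨⟨cp b, b, rfl⟩, ty b⟩ := rfl
  show (∃ h : (e.symm a).1 = (e.symm b).1, F.R () (cast rfl (e.symm a).2) (e.symm b).2) ↔ _
  rw [ea, eb]
  constructor
  · rintro ⟨h, h'⟩
    exact ⟨congrArg Subtype.val h, h'⟩
  · rintro ⟨h, h'⟩
    exact ⟨Subtype.ext h, h'⟩

/-- The data from which the model is built. -/
structure Ctx where
  D : Type
  ρ : Fin 2 → D → D → Prop
  a0 : D
  a1 : D
  a2 : D
  b0 : D
  b1 : D
  h01 : a0 ≠ a1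
  h02 : a0 ≠ a2
  h12 : a1 ≠ a2
  hb : b0 ≠ b1
  r01 : ρ 0 a0 a1
  r12 : ρ 0 a1 a2
  rb : ρ 1 b0 b1
  pl : D → D → D
  pli : D → D → D
  pl_ne : ∀ e d, pl e d ≠ e
  pli_pl : ∀ e d, pli e (pl e d) = d
  pl_pli : ∀ e t, t ≠ e → pl e (pli e t) = t

theorem exists_ctx {C0 C1 : Set (Frame Unit)}
    (h0iso : ClosedUnderIso C0) (h0du : ClosedUnderDU C0)
    (h1iso : ClosedUnderIso C1) (h1du : ClosedUnderDU C1)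
    (hchain : HasChain2 C0) (hedge : HasEdge C1) :
    ∃ c : Ctx, (⟨c.D, fun _ => c.ρ 0⟩ : Frame Unit) ∈ C0 ∧ (⟨c.D, fun _ => c.ρ 1⟩ : Frame Unit) ∈ C1 := by
  obtain ⟨F, hF, w0, w1, w2, h01, h02, h12, r01, r12⟩ := hchain
  obtain ⟨G, hG, v0, v1, hv, rv⟩ := hedge
  let D := ℕ × F.World × G.World
  let ρ : Fin 2 → D → D → Prop := fun k x y =>
    if k = 0 then (x.1 = y.1 ∧ x.2.2 = y.2.2) ∧ F.R () x.2.1 y.2.1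
    else (x.1 = y.1 ∧ x.2.1 = y.2.1) ∧ G.R () x.2.2 y.2.2
  have : Nonempty F.World := ⟨w0⟩
  have : Nonempty G.World := ⟨v0⟩
  have hinf : Infinite D := inferInstanceAs (Infinite (ℕ × F.World × G.World))
  have heq : ∀ e : D, Nonempty (D ≃ {t : D // t ≠ e}) := by
    intro e
    have := Cardinal.mk_compl_of_infinite ({e} : Set D) (by
      rw [Cardinal.mk_singleton]
      exact lt_of_lt_of_le Cardinal.one_lt_aleph0 (Cardinal.aleph0_le_mk D))
    exact Cardinal.eq.mp this.symm
  let E : ∀ e : D, D ≃ {t : D // t ≠ e} := fun e => (heq e).some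
  classical
  refine ⟨⟨D, ρ, (0, w0, v0), (0, w1, v0), (0, w2, v0), (0, w0, v0), (0, w0, v1), ?_, ?_, ?_, ?_,
    ?_, ?_, ?_, fun e d => (E e d).1, fun e t => if h : t ≠ e then (E e).symm ⟨t, h⟩ else t,
    ?_, ?_, ?_⟩, ?_, ?_⟩
  · intro h; exact h01 (congrArg (fun x => x.2.1) h)
  · intro h; exact h02 (congrArg (fun x => x.2.1) h)
  · intro h; exact h12 (congrArg (fun x => x.2.1) h)
  · intro h; exact hv (congrArg (fun x => x.2.2) h)
  · simp [ρ, r01]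
  · simp [ρ, r12]
  · simp [ρ, rv]
  · intro e d; exact (E e d).2
  · intro e d
    simp [(E e d).2]
  · intro e t h
    simp [h]
  · refine mem_of_bij h0iso h0du F hF (fun x : D => (x.1, x.2.2)) (fun x => x.2.1) _ ?_ ?_ ?_
    · intro a b; simp [ρ]
    · rintro ⟨a, b, c⟩ ⟨a', b', c'⟩ h h'
      simp only [Prod.mk.injEq] at h h'
      exact Prod.ext h.1 (Prod.ext h' h.2)
    · rintro ⟨a, b, c⟩ t
      exact ⟨(a, t, c), rfl, rfl⟩
  · refine mem_of_bij h1iso h1du G hG (fun x : D => (x.1, x.2.1)) (fun x => x.2.2) _ ?_ ?_ ?_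
    · intro a b; simp [ρ]
    · rintro ⟨a, b, c⟩ ⟨a', b', c'⟩ h h'
      simp only [Prod.mk.injEq] at h h'
      exact Prod.ext h.1 (Prod.ext h.2 h')
    · rintro ⟨a, b, c⟩ t
      exact ⟨(a, b, t), rfl, rfl⟩

namespace Ctx

variable (c : Ctx)

abbrev W : Type := c.D × List c.D

variable {c}

def lst (w : c.W) : List c.D := w.1 :: w.2

def par (k : Fin 2) (l : List c.D) : Prop := l.length % 2 = k.val

instance (k : Fin 2) (l : List c.D) : Decidable (par k l) := inferInstanceAs (Decidable (_ = _))

theorem par_cons (k : Fin 2) (d : c.D) (l : List c.D) : par k (d :: l) ↔ ¬ par k l := by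
  simp only [par, List.length_cons]
  have := k.2
  omega

open Classical in
noncomputable def ut (l : List c.D) (e d : c.D) : c.D := if l = [] then d else c.pl e d

def cp (k : Fin 2) (w : c.W) : List c.D := if par k w.2 then w.2 else lst w

theorem par_cp (k : Fin 2) (w : c.W) : par k (cp k w) := by
  unfold cp
  split_ifs with h
  · exact h
  · exact (par_cons k _ _).mpr h

noncomputable def tp (e : List c.D → c.D) (k : Fin 2) (w : c.W) : c.D :=
  if par k w.2 then ut w.2 (e w.2) w.1 else e (lst w)

open Classical in
noncomputable def mvl (e : List c.D → c.D) (l : List c.D) (t : c.D) : c.W :=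
  match l with
  | [] => (t, [])
  | d :: l' => if t = e (d :: l') then (d, l') else (c.pli (e (d :: l')) t, d :: l')

noncomputable def mv (e : List c.D → c.D) (k : Fin 2) (w : c.W) (t : c.D) : c.W := mvl e (cp k w) t

theorem cp_mvl (e : List c.D → c.D) (k : Fin 2) (l : List c.D) (h : par k l) (t : c.D) :
    cp k (mvl e l t) = l ∧ tp e k (mvl e l t) = t := by
  cases l with
  | nil => simp [mvl, cp, tp, ut, h]
  | cons d l' =>
    have h' : ¬ par k l' := (par_cons k d l').mp h
    by_cases ht : t = e (d :: l')
    · simp only [mvl, if_pos ht, cp, tp, h', if_false, lst]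
      exact ⟨trivial, ht.symm⟩
    · simp [mvl, if_neg ht, cp, tp, h, ut, c.pl_pli _ _ ht]

theorem cp_mv (e : List c.D → c.D) (k : Fin 2) (w : c.W) (t : c.D) : cp k (mv e k w t) = cp k w :=
  (cp_mvl e k _ (par_cp k w) t).1

theorem tp_mv (e : List c.D → c.D) (k : Fin 2) (w : c.W) (t : c.D) : tp e k (mv e k w t) = t :=
  (cp_mvl e k _ (par_cp k w) t).2

theorem mv_tp (e : List c.D → c.D) (k : Fin 2) (w : c.W) : mv e k w (tp e k w) = w := by
  obtain ⟨d, l⟩ := w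
  by_cases h : par k l
  · simp only [mv, cp, tp, h, if_true]
    cases l with
    | nil => simp [mvl, ut]
    | cons d' l' => simp [mvl, ut, c.pl_ne, c.pli_pl]
  · simp [mv, cp, tp, h, mvl, lst]

def R (e : List c.D → c.D) (k : Fin 2) (w w' : c.W) : Prop :=
  cp k w = cp k w' ∧ c.ρ k (tp e k w) (tp e k w')

theorem R_iff (e : List c.D → c.D) (k : Fin 2) (w w' : c.W) :
    R e k w w' ↔ ∃ t, c.ρ k (tp e k w) t ∧ w' = mv e k w t := by
  constructor
  · rintro ⟨h1, h2⟩
    refine ⟨_, h2, ?_⟩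
    conv_lhs => rw [← mv_tp e k w']
    simp only [mv, h1]
  · rintro ⟨t, h1, rfl⟩
    refine ⟨(cp_mv e k w t).symm, ?_⟩
    rwa [tp_mv]

theorem frame_mem {C0 C1 : Set (Frame Unit)}
    (h0iso : ClosedUnderIso C0) (h0du : ClosedUnderDU C0)
    (h1iso : ClosedUnderIso C1) (h1du : ClosedUnderDU C1)
    (h0 : (⟨c.D, fun _ => c.ρ 0⟩ : Frame Unit) ∈ C0) (h1 : (⟨c.D, fun _ => c.ρ 1⟩ : Frame Unit) ∈ C1)
    (e : List c.D → c.D) : (⟨c.W, R e⟩ : Frame (Fin 2)) ∈ fusion2 C0 C1 := by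
  have inj : ∀ (k : Fin 2) (a b : c.W), cp k a = cp k b → tp e k a = tp e k b → a = b := by
    intro k a b h h'
    rw [← mv_tp e k a, ← mv_tp e k b, mv, mv, h, h']
  have surj : ∀ (k : Fin 2) (a : c.W) (t : c.D), ∃ b, cp k b = cp k a ∧ tp e k b = t :=
    fun k a t => ⟨mv e k a t, cp_mv e k a t, tp_mv e k a t⟩
  exact ⟨mem_of_bij h0iso h0du _ h0 (cp 0) (tp e 0) _ (fun a b => Iff.rfl) (inj 0) (surj 0),
    mem_of_bij h1iso h1du _ h1 (cp 1) (tp e 1) _ (fun a b => Iff.rfl) (inj 1) (surj 1)⟩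

theorem len_mv (e : List c.D → c.D) (k : Fin 2) (w : c.W) (t : c.D) :
    (lst (mv e k w t)).length ≤ (lst w).length + 1 := by
  have h : (cp k w).length ≤ (lst w).length := by
    unfold cp; split_ifs <;> simp [lst]
  have h2 : (lst (mv e k w t)).length ≤ (cp k w).length + 1 := by
    unfold mv
    cases cp k w with
    | nil => simp [mvl, lst]
    | cons d l =>
      simp only [mvl]
      split_ifs <;> simp [lst]
  omega

theorem tp_congr {e e' : List c.D → c.D} {w : c.W}
    (h : ∀ l : List c.D, l.length ≤ (lst w).length → e l = e' l) (k : Fin 2) :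
    tp e k w = tp e' k w := by
  unfold tp
  rw [h w.2 (by simp [lst]), h (lst w) le_rfl]

theorem mv_congr {e e' : List c.D → c.D} {w : c.W}
    (h : ∀ l : List c.D, l.length ≤ (lst w).length → e l = e' l) (k : Fin 2) (t : c.D) :
    mv e k w t = mv e' k w t := by
  have h' : e (cp k w) = e' (cp k w) := by
    apply h; unfold cp; split_ifs <;> simp [lst]
  unfold mv
  revert h'
  cases cp k w with
  | nil => intro _; rfl
  | cons d l => intro h'; unfold mvl; simp only []; rw [h']

end Ctx

end AHS

namespace AHS

set_option linter.unusedVariables false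

open Ctx

structure Role (c : Ctx) (Q : Type) where
  mrk : ℕ
  q : Q
  s : c.W
  tw : c.D
  E : Prop

/-- The data of an automaton together with the frame data. -/
structure AC where
  c : Ctx
  Q : Type
  δ : Q → Tr Q
  Ω : Q → ℕ
  q0 : Q
  q1 : Q
  q2 : Q
  hq : δ q0 = .bin true q1 q2

namespace AC

variable {A : AC}

abbrev Ro (A : AC) : Type := Role A.c A.Q

def val (r : A.Ro) : Set ℕ :=
  {p | (p < 5 ∧ p = r.mrk) ∨ (r.mrk = 1 ∧ ((p = 5 ∧ r.E) ∨ p = 6 + A.Ω r.q))}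

theorem val_mk (r : A.Ro) {m : ℕ} (hm : m < 5) : m ∈ val r ↔ r.mrk = m := by
  simp only [val, Set.mem_ofPred_eq]
  constructor
  · rintro (h | ⟨_, h | h⟩)
    · exact h.2.symm
    · omega
    · omega
  · intro h; exact Or.inl ⟨hm, h.symm⟩

def ee (f : List A.c.D → A.Ro) : List A.c.D → A.c.D := fun l => (f l).tw

def base (A : AC) (k : Fin 2) : A.c.D := if k = 0 then A.c.a0 else A.c.b0
def tip (A : AC) (k : Fin 2) : A.c.D := if k = 0 then A.c.a1 else A.c.b1

theorem base_ne (k : Fin 2) : A.tip k ≠ A.base k := by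
  unfold tip base
  split_ifs
  · exact A.c.h01.symm
  · exact A.c.hb.symm

theorem base_tip (k : Fin 2) : A.c.ρ k (A.base k) (A.tip k) := by
  unfold tip base
  split_ifs with h
  · subst h; exact A.c.r01
  · have : k = 1 := by omega
    subst this; exact A.c.rb

noncomputable def ty (f : List A.c.D → A.Ro) (k : Fin 2) (q : A.Q) (s : A.c.W) : A.c.D :=
  match A.δ q with
  | .mod _ i _ => if i = k then tp (ee f) k s else A.base k
  | _ => A.base k

def Ebit (f : List A.c.D → A.Ro) (q : A.Q) (s : A.c.W) : Prop :=
  match A.δ q with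
  | .lit b p => ¬ (p ∈ val (f (lst s)) ↔ b = true)
  | .var _ => True
  | .bin b _ _ => b = true
  | .mod b _ _ => b = true

open Classical in
noncomputable def Ch (f : List A.c.D → A.Ro) (k : Fin 2) (q : A.Q) (s : A.c.W) (t : A.c.D) :
    Option (A.Q × A.c.W) :=
  match A.δ q with
  | .bin _ q1 q2 => if t = A.tip k then some (if k = 1 then q1 else q2, s) else none
  | .mod _ i q' => if i = k then some (q', mv (ee f) k s t) else
      if t = A.tip k ∧ A.c.ρ i (tp (ee f) i s) (tp (ee f) i s) then some (q', s) else none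
  | _ => none

noncomputable def mkRole (f : List A.c.D → A.Ro) (m : ℕ) (q : A.Q) (s : A.c.W) : A.Ro where
  mrk := m
  q := q
  s := s
  tw := if m = 1 ∨ m = 4 then A.c.b0 else if m = 2 then ty f 1 q s else
    if m = 3 then ty f 0 q s else A.c.a0
  E := m = 1 ∧ Ebit f q s

open Classical in
noncomputable def child (f : List A.c.D → A.Ro) (m : ℕ) (q : A.Q) (s : A.c.W) (t : A.c.D) : A.Ro :=
  if m = 0 then (if t = A.c.a1 then mkRole f 1 q s else if t = A.c.a2 then mkRole f 2 q s
    else mkRole f 5 q s)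
  else if m = 1 then (if t = A.c.b1 then mkRole f 3 q s else mkRole f 5 q s)
  else if m = 2 then (match Ch f 1 q s t with
    | some g => mkRole f 0 g.1 g.2
    | none => mkRole f 5 q s)
  else if m = 3 then (match Ch f 0 q s t with
    | some g => mkRole f 4 g.1 g.2
    | none => mkRole f 5 q s)
  else if m = 4 then (if t = A.c.b1 then mkRole f 0 q s else mkRole f 5 q s)
  else mkRole f 5 q s

/-- congruence: functions agreeing on short lists -/
def Agr (f f' : List A.c.D → A.Ro) (s : A.c.W) : Prop :=
  ∀ l : List A.c.D, l.length ≤ (lst s).length → f l = f' l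

theorem Ch_congr {f f' : List A.c.D → A.Ro} {s : A.c.W} (h : Agr f f' s) (k : Fin 2) (q : A.Q)
    (t : A.c.D) : Ch f k q s t = Ch f' k q s t := by
  have h' : ∀ l : List A.c.D, l.length ≤ (lst s).length → ee f l = ee f' l :=
    fun l hl => congrArg Role.tw (h l hl)
  unfold Ch
  cases A.δ q with
  | mod b i q' =>
    simp only []
    rw [mv_congr h', tp_congr h' i]
  | _ => rfl

theorem mkRole_congr {f f' : List A.c.D → A.Ro} {s : A.c.W} (h : Agr f f' s) (m : ℕ) (q : A.Q) :
    mkRole f m q s = mkRole f' m q s := by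
  have h' : ∀ l : List A.c.D, l.length ≤ (lst s).length → ee f l = ee f' l :=
    fun l hl => congrArg Role.tw (h l hl)
  have h1 : ∀ k, ty f k q s = ty f' k q s := by
    intro k
    unfold ty
    cases A.δ q with
    | mod b i q' => simp only [tp_congr h']
    | _ => rfl
  have h2 : Ebit f q s = Ebit f' q s := by
    unfold Ebit
    cases A.δ q with
    | lit b p => simp only [h (lst s) le_rfl]
    | _ => rfl
  unfold mkRole
  rw [h1, h1, h2]

theorem mkRole_simple (f f' : List A.c.D → A.Ro) {m : ℕ} (h : m = 0 ∨ m = 4 ∨ m = 5) (q : A.Q)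
    (s : A.c.W) : mkRole f m q s = mkRole f' m q s := by
  rcases h with rfl | rfl | rfl <;> simp [mkRole]

theorem mkRole_bin (f f' : List A.c.D → A.Ro) {m : ℕ} {q : A.Q} {b : Bool} {q1 q2 : A.Q}
    (h : A.δ q = .bin b q1 q2)
    (s : A.c.W) : mkRole f m q s = mkRole f' m q s := by
  simp [mkRole, ty, Ebit, h]

theorem child_congr {f f' : List A.c.D → A.Ro} {s : A.c.W} (h : Agr f f' s) (m : ℕ) (q : A.Q)
    (t : A.c.D) : child f m q s t = child f' m q s t := by
  unfold child
  rw [Ch_congr h, Ch_congr h]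
  simp only [mkRole_congr h]
  cases Ch f' 1 q s t <;> cases Ch f' 0 q s t <;>
    simp only [mkRole_simple f f' (m := 4) (by simp), mkRole_simple f f' (m := 0) (by simp)]

theorem child_bin (f f' : List A.c.D → A.Ro) {q : A.Q} {b : Bool} {q1 q2 : A.Q}
    (h : A.δ q = .bin b q1 q2) (s : A.c.W) (t : A.c.D) : child f 0 q s t = child f' 0 q s t := by
  simp only [child, if_true, mkRole_bin f f' h]

def root (A : AC) : A.c.W := (A.c.a1, [])

def r0 (A : AC) : A.Ro := ⟨0, A.q0, A.root, A.c.a0, False⟩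

noncomputable def Fs (A : AC) : List A.c.D → A.Ro
  | [] => A.r0
  | d :: l =>
    let f : List A.c.D → A.Ro := fun l' => if h : l'.length < (d :: l).length then Fs A l' else A.r0
    child f (Fs A l).mrk (Fs A l).q (Fs A l).s (ut l (Fs A l).tw d)
termination_by l => l.length
decreasing_by all_goals first | exact h | simp

noncomputable def tr (A : AC) (m : ℕ) : List A.c.D → A.Ro :=
  fun l' => if l'.length < m then Fs A l' else A.r0

theorem Fs_nil : Fs A [] = A.r0 := by rw [Fs]

theorem Fs_cons' (d : A.c.D) (l : List A.c.D) : Fs A (d :: l) =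
    child (tr A (l.length + 1)) (Fs A l).mrk (Fs A l).q (Fs A l).s (ut l (Fs A l).tw d) := by
  rw [Fs]
  rfl

theorem child_s_len (f : List A.c.D → A.Ro) (m : ℕ) (q : A.Q) (s : A.c.W) (t : A.c.D) :
    (lst (child f m q s t).s).length ≤ (lst s).length + 1 := by
  have hCh : ∀ k g, Ch f k q s t = some g → (lst g.2).length ≤ (lst s).length + 1 := by
    intro k g hg
    unfold Ch at hg
    cases hδ : A.δ q with
    | lit b p => simp [hδ] at hg
    | var x => simp [hδ] at hg
    | bin b q1 q2 =>
      simp only [hδ] at hg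
      split_ifs at hg <;> (cases hg; simp)
    | mod b i q' =>
      simp only [hδ] at hg
      split_ifs at hg
      · cases hg; exact len_mv _ _ _ _
      · cases hg; simp
  unfold child
  split_ifs
  all_goals first
    | (simp [mkRole]; done)
    | (split
       · rename_i g hg; exact hCh _ g hg
       · simp [mkRole])

theorem child0_s (f : List A.c.D → A.Ro) (q : A.Q) (s : A.c.W) (t : A.c.D) :
    (child f 0 q s t).s = s := by
  unfold child
  simp only [if_true]
  split_ifs <;> rfl

theorem s_len : ∀ l : List A.c.D, l ≠ [] → (lst (Fs A l).s).length ≤ l.length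
  | [], h => (h rfl).elim
  | [d], _ => by
      rw [Fs_cons', Fs_nil]
      show (lst (child _ 0 _ A.root _).s).length ≤ _
      rw [child0_s]; simp [lst, root]
  | d :: d' :: l, _ => by
      rw [Fs_cons']
      have h1 := s_len (d' :: l) (by simp)
      have h2 := child_s_len (tr A ((d' :: l).length + 1)) (Fs A (d' :: l)).mrk (Fs A (d' :: l)).q
        (Fs A (d' :: l)).s (ut (d' :: l) (Fs A (d' :: l)).tw d)
      simp only [List.length_cons] at h1 h2 ⊢
      omega

theorem Fs_cons (d : A.c.D) (l : List A.c.D) : Fs A (d :: l) =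
    child (Fs A) (Fs A l).mrk (Fs A l).q (Fs A l).s (ut l (Fs A l).tw d) := by
  rw [Fs_cons']
  by_cases hl : l = []
  · subst hl
    rw [Fs_nil]
    exact child_bin _ _ A.hq _ _
  · apply child_congr
    intro l' hl'
    have := s_len l hl
    simp only [tr]
    rw [if_pos (by omega)]

theorem child_form (f : List A.c.D → A.Ro) (m : ℕ) (q : A.Q) (s : A.c.W) (t : A.c.D) :
    ∃ m' q' s', child f m q s t = mkRole f m' q' s' := by
  unfold child
  split_ifs
  all_goals first
    | exact ⟨_, _, _, rfl⟩
    | (split <;> exact ⟨_, _, _, rfl⟩)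

theorem Fs_form (l : List A.c.D) : Fs A l = mkRole (Fs A) (Fs A l).mrk (Fs A l).q (Fs A l).s := by
  cases l with
  | nil => rw [Fs_nil]; simp [mkRole, r0]
  | cons d l =>
    obtain ⟨m, q, s, h⟩ := child_form (Fs A) (Fs A l).mrk (Fs A l).q (Fs A l).s (ut l (Fs A l).tw d)
    rw [Fs_cons, h]
    rfl

/-- parity of marks -/
def pk (m : ℕ) : Fin 2 := if m = 0 ∨ m = 3 then 0 else 1

theorem child_pk (f : List A.c.D → A.Ro) (m : ℕ) (q : A.Q) (s : A.c.W) (t : A.c.D)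
    (h : (child f m q s t).mrk < 5) : m < 5 ∧ pk (child f m q s t).mrk ≠ pk m := by
  unfold child at h ⊢
  by_cases h0 : m = 0
  · subst h0
    simp only [if_true] at h ⊢
    split_ifs at h ⊢ <;> simp [mkRole, pk] at h ⊢
  by_cases h1 : m = 1
  · subst h1
    simp only [if_true, one_ne_zero, if_false] at h ⊢
    split_ifs at h ⊢ <;> simp [mkRole, pk] at h ⊢
  by_cases h2 : m = 2
  · subst h2
    simp only [if_true, OfNat.ofNat_ne_one, OfNat.ofNat_ne_zero, if_false] at h ⊢
    split at h <;> simp [mkRole, pk] at h ⊢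
  by_cases h3 : m = 3
  · subst h3
    simp only [if_true, OfNat.ofNat_ne_one, OfNat.ofNat_ne_zero, if_false,
      show (3 : ℕ) ≠ 2 by decide] at h ⊢
    split at h <;> simp [mkRole, pk] at h ⊢
  by_cases h4 : m = 4
  · subst h4
    simp only [if_true, OfNat.ofNat_ne_one, OfNat.ofNat_ne_zero, if_false,
      show (4 : ℕ) ≠ 2 by decide, show (4 : ℕ) ≠ 3 by decide] at h ⊢
    split_ifs at h ⊢ <;> simp [mkRole, pk] at h ⊢
  · simp [h0, h1, h2, h3, h4, mkRole] at h

theorem Fs_par : ∀ l : List A.c.D, (Fs A l).mrk < 5 → par (pk (Fs A l).mrk) l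
  | [], _ => by rw [Fs_nil]; simp [par, r0, pk]
  | d :: l, h => by
      have h' := h
      rw [Fs_cons] at h'
      obtain ⟨h1, h2⟩ := child_pk _ _ _ _ _ h'
      rw [← Fs_cons] at h2
      have ih := Fs_par l h1
      rw [par_cons]
      intro h3
      apply h2
      apply Fin.ext
      exact h3.symm.trans ih

end AC

end AHS

namespace AHS

set_option linter.unusedVariables false

open Ctx

/-! Formula side -/

def SuccM {W : Type} (M : KModel (Fin 2) W) (w w' : W) : Prop :=
  (∃ u, M.R 0 w u ∧ u ∈ M.V 2 ∧ ∃ y, M.R 1 u y ∧ y ∈ M.V 0 ∧ M.R 0 y w' ∧ w' ∈ M.V 1) ∨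
  (∃ x, M.R 1 w x ∧ x ∈ M.V 3 ∧ ∃ m, M.R 0 x m ∧ m ∈ M.V 4 ∧
    ∃ y, M.R 1 m y ∧ y ∈ M.V 0 ∧ M.R 0 y w' ∧ w' ∈ M.V 1)

def dm (i : Fin 2) (p : ℕ) (φ : MuForm (Fin 2)) : MuForm (Fin 2) := .dia i (.and (.prop p) φ)
def bx (i : Fin 2) (p : ℕ) (φ : MuForm (Fin 2)) : MuForm (Fin 2) := .box i (.or (.nprop p) φ)

def dS (φ : MuForm (Fin 2)) : MuForm (Fin 2) :=
  .or (dm 0 2 (dm 1 0 (dm 0 1 φ))) (dm 1 3 (dm 0 4 (dm 1 0 (dm 0 1 φ))))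
def bS (φ : MuForm (Fin 2)) : MuForm (Fin 2) :=
  .and (bx 0 2 (bx 1 0 (bx 0 1 φ))) (bx 1 3 (bx 0 4 (bx 1 0 (bx 0 1 φ))))

def thT (j : ℕ) : MuForm (Fin 2) :=
  .and (.prop (6 + j)) (.or (.and (.prop 5) (dS (.var j))) (.and (.nprop 5) (bS (.var j))))

def th : ℕ → MuForm (Fin 2)
  | 0 => thT 0
  | j + 1 => .or (th j) (thT (j + 1))

theorem th_noFix : ∀ n, (th n).noFix
  | 0 => by simp [th, thT, dS, bS, dm, bx, MuForm.noFix]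
  | j + 1 => ⟨th_noFix j, by simp [thT, dS, bS, dm, bx, MuForm.noFix]⟩

section
variable {W : Type} (M : KModel (Fin 2) W) (Y : ℕ → Set W)

theorem mem_dm (i : Fin 2) (p : ℕ) (φ : MuForm (Fin 2)) (w : W) :
    w ∈ MuForm.sem M Y (dm i p φ) ↔ ∃ v, M.R i w v ∧ v ∈ M.V p ∧ v ∈ MuForm.sem M Y φ := Iff.rfl

theorem mem_bx (i : Fin 2) (p : ℕ) (φ : MuForm (Fin 2)) (w : W) :
    w ∈ MuForm.sem M Y (bx i p φ) ↔ ∀ v, M.R i w v → v ∈ M.V p → v ∈ MuForm.sem M Y φ := by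
  show (∀ v, M.R i w v → (v ∉ M.V p ∨ v ∈ MuForm.sem M Y φ)) ↔ _
  refine forall_congr' fun v => imp_congr_right fun _ => ?_
  tauto

theorem mem_dS (φ : MuForm (Fin 2)) (w : W) :
    w ∈ MuForm.sem M Y (dS φ) ↔ ∃ w', SuccM M w w' ∧ w' ∈ MuForm.sem M Y φ := by
  show (w ∈ MuForm.sem M Y (dm _ _ _) ∨ w ∈ MuForm.sem M Y (dm _ _ _)) ↔ _
  simp only [mem_dm, SuccM]
  constructor
  · rintro (⟨u, h1, h2, y, h3, h4, w', h5, h6, h7⟩ | ⟨x, h1, h2, m, h8, h9, y, h3, h4, w', h5, h6, h7⟩)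
    · exact ⟨w', Or.inl ⟨u, h1, h2, y, h3, h4, h5, h6⟩, h7⟩
    · exact ⟨w', Or.inr ⟨x, h1, h2, m, h8, h9, y, h3, h4, h5, h6⟩, h7⟩
  · rintro ⟨w', ⟨u, h1, h2, y, h3, h4, h5, h6⟩ | ⟨x, h1, h2, m, h8, h9, y, h3, h4, h5, h6⟩, h7⟩
    · exact Or.inl ⟨u, h1, h2, y, h3, h4, w', h5, h6, h7⟩
    · exact Or.inr ⟨x, h1, h2, m, h8, h9, y, h3, h4, w', h5, h6, h7⟩

theorem mem_bS (φ : MuForm (Fin 2)) (w : W) :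
    w ∈ MuForm.sem M Y (bS φ) ↔ ∀ w', SuccM M w w' → w' ∈ MuForm.sem M Y φ := by
  show (w ∈ MuForm.sem M Y (bx _ _ _) ∧ w ∈ MuForm.sem M Y (bx _ _ _)) ↔ _
  simp only [mem_bx, SuccM]
  constructor
  · rintro ⟨ha, hb⟩ w' (⟨u, h1, h2, y, h3, h4, h5, h6⟩ | ⟨x, h1, h2, m, h8, h9, y, h3, h4, h5, h6⟩)
    · exact ha u h1 h2 y h3 h4 w' h5 h6
    · exact hb x h1 h2 m h8 h9 y h3 h4 w' h5 h6
  · intro h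
    constructor
    · intro u h1 h2 y h3 h4 w' h5 h6
      exact h w' (Or.inl ⟨u, h1, h2, y, h3, h4, h5, h6⟩)
    · intro x h1 h2 m h8 h9 y h3 h4 w' h5 h6
      exact h w' (Or.inr ⟨x, h1, h2, m, h8, h9, y, h3, h4, h5, h6⟩)

theorem mem_thT (j : ℕ) (w : W) : w ∈ MuForm.sem M Y (thT j) ↔
    w ∈ M.V (6 + j) ∧ ((w ∈ M.V 5 ∧ ∃ w', SuccM M w w' ∧ w' ∈ Y j) ∨
      (w ∉ M.V 5 ∧ ∀ w', SuccM M w w' → w' ∈ Y j)) := by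
  have h1 := mem_dS M Y (.var j) w
  have h2 := mem_bS M Y (.var j) w
  show (w ∈ M.V (6 + j) ∧ ((w ∈ M.V 5 ∧ w ∈ MuForm.sem M Y (dS (.var j))) ∨
    (w ∉ M.V 5 ∧ w ∈ MuForm.sem M Y (bS (.var j))))) ↔ _
  rw [h1, h2]
  rfl

theorem mem_th (n : ℕ) (w : W) : w ∈ MuForm.sem M Y (th n) ↔
    ∃ j, j < n + 1 ∧ w ∈ MuForm.sem M Y (thT j) := by
  induction n with
  | zero =>
    constructor
    · intro h; exact ⟨0, by omega, h⟩
    · rintro ⟨j, hj, h⟩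
      have : j = 0 := by omega
      subst this; exact h
  | succ n ih =>
    show (w ∈ MuForm.sem M Y (th n) ∨ w ∈ MuForm.sem M Y (thT (n + 1))) ↔ _
    rw [ih]
    constructor
    · rintro (⟨j, hj, h⟩ | h)
      · exact ⟨j, by omega, h⟩
      · exact ⟨n + 1, by omega, h⟩
    · rintro ⟨j, hj, h⟩
      by_cases hj' : j = n + 1
      · subst hj'; exact Or.inr h
      · exact Or.inl ⟨j, by omega, h⟩

end

theorem th_mono {W : Type} (M : KModel (Fin 2) W) (n : ℕ) :
    Monotone (fun Y : ℕ → Set W => MuForm.sem M Y (th n)) := by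
  intro Y Y' h w hw
  rw [mem_th] at hw ⊢
  obtain ⟨j, hj, hw⟩ := hw
  refine ⟨j, hj, ?_⟩
  rw [mem_thT] at hw ⊢
  obtain ⟨h1, ⟨h2, w', h3, h4⟩ | ⟨h2, h3⟩⟩ := hw
  · exact ⟨h1, Or.inl ⟨h2, w', h3, h j h4⟩⟩
  · exact ⟨h1, Or.inr ⟨h2, fun w' hw' => h j (h3 w' hw')⟩⟩

theorem th_dep {W : Type} (M : KModel (Fin 2) W) (n : ℕ) (Y Y' : ℕ → Set W)
    (h : ∀ j, j < n + 1 → Y j = Y' j) : MuForm.sem M Y (th n) = MuForm.sem M Y' (th n) := by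
  ext w
  rw [mem_th, mem_th]
  refine exists_congr fun j => and_congr_right fun hj => ?_
  rw [mem_thT, mem_thT, h j hj]

theorem N_indep {L : Type} [CompleteLattice L] {F : (ℕ → L) → L} (m : ℕ)
    (h : ∀ Y Y', (∀ j, j < m → Y j = Y' j) → F Y = F Y') :
    ∀ (n : ℕ) (b : Bool) (Y Y' : ℕ → L), (∀ j, n ≤ j → j < m → Y j = Y' j) →
      N b n F Y = N b n F Y'
  | 0, _, Y, Y', hY => h Y Y' (fun j hj => hY j (Nat.zero_le _) hj)
  | n + 1, b, Y, Y', hY => by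
      rw [N, N]
      congr 1
      funext X
      apply N_indep m h
      intro j hj hj'
      by_cases e : j = n
      · subst e; simp
      · simp only [Function.update, e, dif_neg, not_false_eq_true]
        exact hY j (by omega) hj'

/-! Model side -/

namespace AC

variable {A : AC}

noncomputable def rl (w : A.c.W) : A.Ro := Fs A (lst w)

noncomputable abbrev E (A : AC) : List A.c.D → A.c.D := ee (Fs A)

noncomputable def mdl (A : AC) : KModel (Fin 2) A.c.W := ⟨R (E A), fun p => {w | p ∈ val (rl w)}⟩

def Is (m : ℕ) (g : A.Q × A.c.W) (w : A.c.W) : Prop := rl w = mkRole (Fs A) m g.1 g.2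

theorem Is_mrk {m : ℕ} {g : A.Q × A.c.W} {w : A.c.W} (h : Is m g w) : (rl w).mrk = m := by
  rw [h]; rfl

theorem Is_V {m : ℕ} {g : A.Q × A.c.W} {w : A.c.W} (h : Is m g w) (hm : m < 5) :
    w ∈ (mdl A).V m := (val_mk _ hm).mpr (Is_mrk h)

theorem V_mrk {m : ℕ} (hm : m < 5) {w : A.c.W} (h : w ∈ (mdl A).V m) : (rl w).mrk = m :=
  (val_mk _ hm).mp h

theorem rl_mvl_ne (l : List A.c.D) (t : A.c.D) (h : l = [] ∨ t ≠ (Fs A l).tw) :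
    rl (mvl (E A) l t) = child (Fs A) (Fs A l).mrk (Fs A l).q (Fs A l).s t := by
  cases l with
  | nil =>
    show Fs A (t :: []) = _
    rw [Fs_cons]; simp [ut]
  | cons d l =>
    have h' : t ≠ (Fs A (d :: l)).tw := h.resolve_left (by simp)
    have : mvl (E A) (d :: l) t = (A.c.pli (Fs A (d :: l)).tw t, d :: l) := by
      unfold mvl; exact if_neg h'
    rw [this]
    show Fs A (_ :: d :: l) = _
    rw [Fs_cons, ut, if_neg (by simp), A.c.pl_pli _ _ h']

theorem rl_mvl_eq (l : List A.c.D) (hl : l ≠ []) : rl (mvl (E A) l (Fs A l).tw) = Fs A l := by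
  cases l with
  | nil => exact (hl rfl).elim
  | cons d l =>
    have : mvl (E A) (d :: l) (Fs A (d :: l)).tw = (d, l) := by
      unfold mvl; exact if_pos rfl
    rw [this]; rfl

theorem tp_desc {k : Fin 2} {w : A.c.W} (h : par k (lst w)) :
    cp k w = lst w ∧ tp (E A) k w = (rl w).tw := by
  have h' : ¬ par k w.2 := (par_cons k _ _).mp h
  simp only [cp, tp, if_neg h']
  exact ⟨trivial, rfl⟩

theorem desc_fwd {k : Fin 2} {w w' : A.c.W} (h : par k (lst w)) (hR : R (E A) k w w')
    (hm : (rl w').mrk ≠ (rl w).mrk) : ∃ t, t ≠ (rl w).tw ∧ A.c.ρ k (rl w).tw t ∧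
      rl w' = child (Fs A) (rl w).mrk (rl w).q (rl w).s t := by
  obtain ⟨h1, h2⟩ := tp_desc h
  obtain ⟨t, h3, h4⟩ := (R_iff _ _ _ _).mp hR
  rw [h2] at h3
  rw [mv, h1] at h4
  have ht : t ≠ (rl w).tw := by
    rintro rfl
    apply hm
    rw [h4]
    exact congrArg Role.mrk (rl_mvl_eq (lst w) (by simp [lst]))
  exact ⟨t, ht, h3, by rw [h4]; exact rl_mvl_ne _ _ (Or.inr ht)⟩

theorem desc_bwd {k : Fin 2} {w : A.c.W} (h : par k (lst w)) {t : A.c.D}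
    (ht : t ≠ (rl w).tw) (hr : A.c.ρ k (rl w).tw t) : ∃ w', R (E A) k w w' ∧
      rl w' = child (Fs A) (rl w).mrk (rl w).q (rl w).s t := by
  obtain ⟨h1, h2⟩ := tp_desc h
  refine ⟨mv (E A) k w t, (R_iff _ _ _ _).mpr ⟨t, by rw [h2]; exact hr, rfl⟩, ?_⟩
  rw [mv, h1]
  exact rl_mvl_ne _ _ (Or.inr ht)

theorem Is_par {m : ℕ} {g : A.Q × A.c.W} {w : A.c.W} (h : Is m g w) (hm : m < 5) :
    par (pk m) (lst w) := by
  have h1 := Is_mrk h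
  have := Fs_par (lst w) (by rw [← h1] at hm; exact hm)
  rwa [show (Fs A (lst w)).mrk = m from h1] at this

/-- descent in terms of roles -/
theorem fwd' {m : ℕ} {g : A.Q × A.c.W} {w w' : A.c.W} (h : Is m g w) (hm : m < 5) {k : Fin 2}
    (hk : pk m = k) (hR : R (E A) k w w') (hm' : (rl w').mrk ≠ m) :
    ∃ t, t ≠ (mkRole (Fs A) m g.1 g.2).tw ∧ A.c.ρ k (mkRole (Fs A) m g.1 g.2).tw t ∧
      rl w' = child (Fs A) m g.1 g.2 t := by
  subst hk
  have := desc_fwd (Is_par h hm) hR (by rw [Is_mrk h]; exact hm')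
  rw [h] at this
  exact this

theorem bwd' {m : ℕ} {g : A.Q × A.c.W} {w : A.c.W} (h : Is m g w) (hm : m < 5) {k : Fin 2}
    (hk : pk m = k) {t : A.c.D} (ht : t ≠ (mkRole (Fs A) m g.1 g.2).tw)
    (hr : A.c.ρ k (mkRole (Fs A) m g.1 g.2).tw t) :
    ∃ w', R (E A) k w w' ∧ rl w' = child (Fs A) m g.1 g.2 t := by
  subst hk
  have := desc_bwd (t := t) (Is_par h hm) (by rw [h]; exact ht) (by rw [h]; exact hr)
  rw [h] at this
  exact this

theorem YP_f {g : A.Q × A.c.W} {w w' : A.c.W} (h : Is 0 g w) (hR : R (E A) 0 w w')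
    (hm : (rl w').mrk = 1) : Is 1 g w' := by
  obtain ⟨t, _, _, h3⟩ := fwd' h (by omega) rfl hR (by omega)
  rw [h3] at hm
  unfold Is
  rw [h3]
  unfold child at hm ⊢
  simp only [if_true] at hm ⊢
  split_ifs at hm ⊢
  · rfl
  · simp [mkRole] at hm
  · simp [mkRole] at hm

theorem YP_b {g : A.Q × A.c.W} {w : A.c.W} (h : Is 0 g w) : ∃ w', R (E A) 0 w w' ∧ Is 1 g w' := by
  obtain ⟨w', h1, h2⟩ := bwd' h (by omega) (k := 0) rfl (t := A.c.a1) (by simpa [mkRole] using A.c.h01.symm)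
    (by simpa [mkRole] using A.c.r01)
  exact ⟨w', h1, by rw [Is, h2]; simp [child]⟩

theorem PX_f {g : A.Q × A.c.W} {w w' : A.c.W} (h : Is 1 g w) (hR : R (E A) 1 w w')
    (hm : (rl w').mrk = 3) : Is 3 g w' := by
  obtain ⟨t, _, _, h3⟩ := fwd' h (by omega) rfl hR (by omega)
  rw [h3] at hm
  unfold Is
  rw [h3]
  unfold child at hm ⊢
  simp only [if_true, one_ne_zero, if_false] at hm ⊢
  split_ifs at hm ⊢
  · rfl
  · simp [mkRole] at hm

theorem PX_b {g : A.Q × A.c.W} {w : A.c.W} (h : Is 1 g w) : ∃ w', R (E A) 1 w w' ∧ Is 3 g w' := by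
  obtain ⟨w', h1, h2⟩ := bwd' h (by omega) (k := 1) rfl (t := A.c.b1) (by simpa [mkRole] using A.c.hb.symm)
    (by simpa [mkRole] using A.c.rb)
  exact ⟨w', h1, by rw [Is, h2]; simp [child]⟩

theorem MY_f {g : A.Q × A.c.W} {w w' : A.c.W} (h : Is 4 g w) (hR : R (E A) 1 w w')
    (hm : (rl w').mrk = 0) : Is 0 g w' := by
  obtain ⟨t, _, _, h3⟩ := fwd' h (by omega) rfl hR (by omega)
  rw [h3] at hm
  unfold Is
  rw [h3]
  by_cases ht : t = A.c.b1
  · simp [child, ht]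
  · simp [child, ht, mkRole] at hm

theorem MY_b {g : A.Q × A.c.W} {w : A.c.W} (h : Is 4 g w) : ∃ w', R (E A) 1 w w' ∧ Is 0 g w' := by
  obtain ⟨w', h1, h2⟩ := bwd' h (by omega) (k := 1) rfl (t := A.c.b1) (by simpa [mkRole] using A.c.hb.symm)
    (by simpa [mkRole] using A.c.rb)
  exact ⟨w', h1, by rw [Is, h2]; simp [child]⟩

theorem UY_f {g : A.Q × A.c.W} {w w' : A.c.W} (h : Is 2 g w) (hR : R (E A) 1 w w')
    (hm : (rl w').mrk = 0) : ∃ g' t, t ≠ ty (Fs A) 1 g.1 g.2 ∧ A.c.ρ 1 (ty (Fs A) 1 g.1 g.2) t ∧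
      Ch (Fs A) 1 g.1 g.2 t = some g' ∧ Is 0 g' w' := by
  obtain ⟨t, h1, h2, h3⟩ := fwd' h (by omega) rfl hR (by omega)
  simp only [mkRole, OfNat.ofNat_ne_one, or_self, if_false, if_true,
    show ¬ ((2 : ℕ) = 4) by decide] at h1 h2
  rw [h3] at hm
  simp only [child, OfNat.ofNat_ne_one, OfNat.ofNat_ne_zero, if_false, if_true] at hm h3
  cases hc : Ch (Fs A) 1 g.1 g.2 t with
  | none => simp [hc, mkRole] at hm
  | some g' =>
    rw [hc] at h3
    exact ⟨g', t, h1, h2, hc, h3⟩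

theorem UY_b {g g' : A.Q × A.c.W} {w : A.c.W} (h : Is 2 g w) {t : A.c.D}
    (h1 : t ≠ ty (Fs A) 1 g.1 g.2) (h2 : A.c.ρ 1 (ty (Fs A) 1 g.1 g.2) t)
    (h3 : Ch (Fs A) 1 g.1 g.2 t = some g') : ∃ w', R (E A) 1 w w' ∧ Is 0 g' w' := by
  obtain ⟨w', h4, h5⟩ := bwd' h (by omega) (k := 1) rfl (t := t) (by simpa [mkRole] using h1)
    (by simpa [mkRole] using h2)
  exact ⟨w', h4, by rw [Is, h5]; simp [child, h3]⟩

theorem XM_f {g : A.Q × A.c.W} {w w' : A.c.W} (h : Is 3 g w) (hR : R (E A) 0 w w')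
    (hm : (rl w').mrk = 4) : ∃ g' t, t ≠ ty (Fs A) 0 g.1 g.2 ∧ A.c.ρ 0 (ty (Fs A) 0 g.1 g.2) t ∧
      Ch (Fs A) 0 g.1 g.2 t = some g' ∧ Is 4 g' w' := by
  obtain ⟨t, h1, h2, h3⟩ := fwd' h (by omega) rfl hR (by omega)
  simp only [mkRole, OfNat.ofNat_ne_one, or_self, if_false, if_true,
    show ¬ ((3 : ℕ) = 4) by decide, show ¬ ((3 : ℕ) = 2) by decide] at h1 h2
  rw [h3] at hm
  simp only [child, OfNat.ofNat_ne_one, OfNat.ofNat_ne_zero, if_false, if_true,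
    show ¬ ((3 : ℕ) = 2) by decide] at hm h3
  cases hc : Ch (Fs A) 0 g.1 g.2 t with
  | none => simp [hc, mkRole] at hm
  | some g' =>
    rw [hc] at h3
    exact ⟨g', t, h1, h2, hc, h3⟩

theorem XM_b {g g' : A.Q × A.c.W} {w : A.c.W} (h : Is 3 g w) {t : A.c.D}
    (h1 : t ≠ ty (Fs A) 0 g.1 g.2) (h2 : A.c.ρ 0 (ty (Fs A) 0 g.1 g.2) t)
    (h3 : Ch (Fs A) 0 g.1 g.2 t = some g') : ∃ w', R (E A) 0 w w' ∧ Is 4 g' w' := by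
  obtain ⟨w', h4, h5⟩ := bwd' h (by omega) (k := 0) rfl (t := t) (by simpa [mkRole] using h1)
    (by simpa [mkRole] using h2)
  exact ⟨w', h4, by rw [Is, h5]; simp [child, h3]⟩

theorem child_one {f : List A.c.D → A.Ro} {m : ℕ} {q : A.Q} {s : A.c.W} {t : A.c.D}
    (h : (child f m q s t).mrk = 1) : m = 0 ∧ t = A.c.a1 := by
  unfold child at h
  split_ifs at h with h1 h2 <;> first
    | exact ⟨h1, h2⟩
    | (simp [mkRole] at h; done)
    | (split at h <;> simp [mkRole] at h)

theorem P_par {g : A.Q × A.c.W} {w : A.c.W} (h : Is 1 g w) :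
    cp 0 w = w.2 ∧ tp (E A) 0 w = A.c.a1 ∧ (Fs A w.2).mrk = 0 ∧ (Fs A w.2).q = g.1 ∧
      (Fs A w.2).s = g.2 ∧ (Fs A w.2).tw = A.c.a0 := by
  have hp := Is_par h (by omega)
  have hp0 : par 0 w.2 := by
    have := (par_cons _ _ _).mp hp
    simp only [par, pk] at this ⊢
    simp at this ⊢
    omega
  have h1 : Fs A (w.1 :: w.2) = mkRole (Fs A) 1 g.1 g.2 := h
  rw [Fs_cons] at h1
  have h2 := congrArg Role.mrk h1
  obtain ⟨h3, h4⟩ := child_one h2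
  rw [h3, h4] at h1
  simp only [child, if_true] at h1
  refine ⟨by simp only [cp, if_pos hp0], by simp only [tp, if_pos hp0]; exact h4, h3,
    congrArg Role.q h1, congrArg Role.s h1, ?_⟩
  rw [Fs_form, h3]
  simp [mkRole]

theorem PU_f {g : A.Q × A.c.W} {w w' : A.c.W} (h : Is 1 g w) (hR : R (E A) 0 w w')
    (hm : (rl w').mrk = 2) : Is 2 g w' := by
  obtain ⟨h1, h2, h3, h4, h5, h6⟩ := P_par h
  obtain ⟨t, _, h8⟩ := (R_iff _ _ _ _).mp hR
  rw [mv, h1] at h8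
  by_cases ht : w.2 = [] ∨ t ≠ (Fs A w.2).tw
  · have h9 := rl_mvl_ne _ _ ht
    rw [← h8, h3, h4, h5] at h9
    rw [h9] at hm
    rw [Is, h9]
    simp only [child, if_true] at hm ⊢
    split_ifs at hm ⊢
    · simp [mkRole] at hm
    · rfl
    · simp [mkRole] at hm
  · push Not at ht
    have h9 := rl_mvl_eq w.2 ht.1
    rw [← ht.2, ← h8] at h9
    rw [h9, h3] at hm
    omega

theorem PU_b {g : A.Q × A.c.W} {w : A.c.W} (h : Is 1 g w) : ∃ w', R (E A) 0 w w' ∧ Is 2 g w' := by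
  obtain ⟨h1, h2, h3, h4, h5, h6⟩ := P_par h
  refine ⟨mv (E A) 0 w A.c.a2, (R_iff _ _ _ _).mpr ⟨_, by rw [h2]; exact A.c.r12, rfl⟩, ?_⟩
  rw [mv, h1, Is, rl_mvl_ne _ _ (Or.inr (by rw [h6]; exact A.c.h02.symm)), h3, h4, h5]
  simp [child, A.c.h12.symm]

/-- one step of the acceptance game -/
def GC (g g' : A.Q × A.c.W) : Prop :=
  match A.δ g.1 with
  | .bin _ q1 q2 => g' = (q1, g.2) ∨ g' = (q2, g.2)
  | .mod _ i q' => ∃ v, R (E A) i g.2 v ∧ g' = (q', v)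
  | _ => False

theorem ch_f {g g' : A.Q × A.c.W} {k : Fin 2} {t : A.c.D}
    (h2 : A.c.ρ k (ty (Fs A) k g.1 g.2) t) (h3 : Ch (Fs A) k g.1 g.2 t = some g') : GC g g' := by
  unfold Ch at h3
  unfold ty at h2
  unfold GC
  cases hδ : A.δ g.1 with
  | lit b p => simp [hδ] at h3
  | var x => simp [hδ] at h3
  | bin b q1 q2 =>
    simp only [hδ] at h3
    split_ifs at h3 <;> cases h3 <;> simp
  | mod b i q' =>
    simp only [hδ] at h3 h2
    split_ifs at h3 with h4 h5
    · subst h4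
      simp only [if_true] at h2
      cases h3
      exact ⟨_, (R_iff _ _ _ _).mpr ⟨t, h2, rfl⟩, rfl⟩
    · cases h3
      exact ⟨g.2, (R_iff _ _ _ _).mpr ⟨_, h5.2, (mv_tp _ _ _).symm⟩, rfl⟩

theorem ch_b {g g' : A.Q × A.c.W} (h : GC g g') : ∃ k t, t ≠ ty (Fs A) k g.1 g.2 ∧
    A.c.ρ k (ty (Fs A) k g.1 g.2) t ∧ Ch (Fs A) k g.1 g.2 t = some g' := by
  unfold GC at h
  cases hδ : A.δ g.1 with
  | lit b p => simp [hδ] at h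
  | var x => simp [hδ] at h
  | bin b q1 q2 =>
    simp only [hδ] at h
    rcases h with rfl | rfl
    · exact ⟨1, A.tip 1, by simp only [ty, hδ]; exact base_ne 1, by simp only [ty, hδ]; exact base_tip 1,
        by simp [Ch, hδ]⟩
    · exact ⟨0, A.tip 0, by simp only [ty, hδ]; exact base_ne 0, by simp only [ty, hδ]; exact base_tip 0,
        by simp [Ch, hδ]⟩
  | mod b i q' =>
    simp only [hδ] at h
    obtain ⟨v, hv, rfl⟩ := h
    obtain ⟨t, h1, h2⟩ := (R_iff _ _ _ _).mp hv
    by_cases ht : t = tp (E A) i g.2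
    · subst ht
      rw [mv_tp] at h2
      subst h2
      have : ∃ k : Fin 2, i ≠ k := ⟨i + 1, by omega⟩
      obtain ⟨k, hk⟩ := this
      refine ⟨k, A.tip k, by simp only [ty, hδ, if_neg hk]; exact base_ne k,
        by simp only [ty, hδ, if_neg hk]; exact base_tip k, ?_⟩
      simp only [Ch, hδ, if_neg hk]
      rw [if_pos ⟨rfl, h1⟩]
    · refine ⟨i, t, by simp only [ty, hδ, if_true]; exact ht, by simp only [ty, hδ, if_true]; exact h1, ?_⟩
      simp only [Ch, hδ, if_true]
      rw [h2]

theorem succ_f {g : A.Q × A.c.W} {w w' : A.c.W} (h : Is 1 g w) (hs : SuccM (mdl A) w w') :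
    ∃ g', GC g g' ∧ Is 1 g' w' := by
  rcases hs with ⟨u, h1, h2, y, h3, h4, h5, h6⟩ | ⟨x, h1, h2, m, h8, h9, y, h3, h4, h5, h6⟩
  · have hu := PU_f h h1 (V_mrk (by omega) h2)
    obtain ⟨g', t, ha, hb, hc, hy⟩ := UY_f hu h3 (V_mrk (by omega) h4)
    exact ⟨g', ch_f hb hc, YP_f hy h5 (V_mrk (by omega) h6)⟩
  · have hx := PX_f h h1 (V_mrk (by omega) h2)
    obtain ⟨g', t, ha, hb, hc, hy⟩ := XM_f hx h8 (V_mrk (by omega) h9)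
    have hy' := MY_f hy h3 (V_mrk (by omega) h4)
    exact ⟨g', ch_f hb hc, YP_f hy' h5 (V_mrk (by omega) h6)⟩

theorem succ_b {g g' : A.Q × A.c.W} {w : A.c.W} (h : Is 1 g w) (hg : GC g g') :
    ∃ w', SuccM (mdl A) w w' ∧ Is 1 g' w' := by
  obtain ⟨k, t, h1, h2, h3⟩ := ch_b hg
  have hk : k = 0 ∨ k = 1 := by omega
  rcases hk with rfl | rfl
  · obtain ⟨x, r1, i1⟩ := PX_b h
    obtain ⟨m, r2, i2⟩ := XM_b i1 h1 h2 h3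
    obtain ⟨y, r3, i3⟩ := MY_b i2
    obtain ⟨w', r4, i4⟩ := YP_b i3
    exact ⟨w', Or.inr ⟨x, r1, Is_V i1 (by omega), m, r2, Is_V i2 (by omega), y, r3,
      Is_V i3 (by omega), r4, Is_V i4 (by omega)⟩, i4⟩
  · obtain ⟨x, r1, i1⟩ := PU_b h
    obtain ⟨y, r3, i3⟩ := UY_b i1 h1 h2 h3
    obtain ⟨w', r4, i4⟩ := YP_b i3
    exact ⟨w', Or.inl ⟨x, r1, Is_V i1 (by omega), y, r3,
      Is_V i3 (by omega), r4, Is_V i4 (by omega)⟩, i4⟩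

theorem V5 {g : A.Q × A.c.W} {w : A.c.W} (h : Is 1 g w) :
    w ∈ (mdl A).V 5 ↔ Ebit (Fs A) g.1 g.2 := by
  show 5 ∈ val (rl w) ↔ _
  rw [h]
  simp only [val, mkRole, Set.mem_ofPred_eq]
  constructor
  · rintro (h | ⟨_, h | h⟩)
    · omega
    · exact h.2.2
    · omega
  · intro h; exact Or.inr ⟨trivial, Or.inl ⟨trivial, trivial, h⟩⟩

theorem V6 {g : A.Q × A.c.W} {w : A.c.W} (h : Is 1 g w) (j : ℕ) :
    w ∈ (mdl A).V (6 + j) ↔ j = A.Ω g.1 := by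
  show 6 + j ∈ val (rl w) ↔ _
  rw [h]
  simp only [val, mkRole, Set.mem_ofPred_eq]
  constructor
  · rintro (h | ⟨_, h | h⟩)
    · omega
    · omega
    · omega
  · rintro rfl; exact Or.inr ⟨trivial, Or.inr rfl⟩

theorem evalT_iff (g : A.Q × A.c.W) (Z : Set (A.Q × A.c.W)) :
    evalT (mdl A) (fun _ => ∅) (A.δ g.1) Z g.2 ↔
      (Ebit (Fs A) g.1 g.2 ∧ ∃ g', GC g g' ∧ g' ∈ Z) ∨
      (¬ Ebit (Fs A) g.1 g.2 ∧ ∀ g', GC g g' → g' ∈ Z) := by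
  unfold Ebit GC
  cases hδ : A.δ g.1 with
  | lit b p =>
    show (p ∈ val (Fs A (lst g.2)) ↔ b = true) ↔ _
    simp
  | var x => simp [evalT]
  | bin b q1 q2 =>
    cases b
    · simp [evalT]
    · simp [evalT]
  | mod b i q =>
    cases b
    · simp only [evalT, Bool.false_eq_true, false_and, false_or, not_false_eq_true, true_and]
      constructor
      · rintro h g' ⟨v, hv, rfl⟩; exact h v hv
      · intro h v hv; exact h _ ⟨v, hv, rfl⟩
    · simp only [evalT, true_and, not_true_eq_false, false_and, or_false]
      constructor
      · rintro ⟨v, hv, h⟩; exact ⟨_, ⟨v, hv, rfl⟩, h⟩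
      · rintro ⟨g', ⟨v, hv, rfl⟩, h⟩; exact ⟨v, hv, h⟩

theorem main (n : ℕ) (hΩ : ∀ q, A.Ω q < n + 1) (env : ℕ → Set A.c.W) :
    A.root ∈ MuForm.sem (mdl A) env (bnd true (n + 1) (th n)) ↔
      (A.q0, A.root) ∈ N true (n + 1) (stepF (mdl A) (fun _ => ∅) A.δ A.Ω) (fun _ => ∅) := by
  rw [sem_bnd, N_indep (n + 1) (th_dep (mdl A) n) (n + 1) true env (fun _ => ∅)
    (fun j h h' => by omega)]
  have hR := RelOK_pt
    (φ := fun (i : {p : A.c.W × (A.Q × A.c.W) // Is 1 p.2 p.1}) (Z : Set A.c.W) => i.1.1 ∈ Z)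
    (ψ := fun (i : {p : A.c.W × (A.Q × A.c.W) // Is 1 p.2 p.1}) (Z : Set (A.Q × A.c.W)) => i.1.2 ∈ Z)
    (fun p => Pt_mem _) (fun p => Pt_mem _)
  refine N_rel hR (th_mono (mdl A) n) (stepF_mono _ _ _ _) ?_ (n + 1) true _ _ (fun j i => by simp)
    ⟨(A.root, (A.q0, A.root)), ?_⟩
  · rintro Y Y' hY ⟨⟨w, g⟩, hw⟩
    have hw : Is 1 g w := hw
    show w ∈ MuForm.sem (mdl A) Y (th n) ↔ evalT (mdl A) (fun _ => ∅) (A.δ g.1) (Y' (A.Ω g.1)) g.2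
    rw [evalT_iff, mem_th]
    have e1 : (∃ j, j < n + 1 ∧ w ∈ MuForm.sem (mdl A) Y (thT j)) ↔
        ((w ∈ (mdl A).V 5 ∧ ∃ w', SuccM (mdl A) w w' ∧ w' ∈ Y (A.Ω g.1)) ∨
        (w ∉ (mdl A).V 5 ∧ ∀ w', SuccM (mdl A) w w' → w' ∈ Y (A.Ω g.1))) := by
      constructor
      · rintro ⟨j, hj, h⟩
        rw [mem_thT, V6 hw] at h
        obtain ⟨rfl, h⟩ := h
        exact h
      · intro h
        exact ⟨_, hΩ g.1, (mem_thT _ _ _ _).mpr ⟨(V6 hw _).mpr rfl, h⟩⟩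
    rw [e1, V5 hw]
    have e2 : (∃ w', SuccM (mdl A) w w' ∧ w' ∈ Y (A.Ω g.1)) ↔ ∃ g', GC g g' ∧ g' ∈ Y' (A.Ω g.1) := by
      constructor
      · rintro ⟨w', h1, h2⟩
        obtain ⟨g', h3, h4⟩ := succ_f hw h1
        exact ⟨g', h3, (hY _ ⟨(w', g'), h4⟩).mp h2⟩
      · rintro ⟨g', h1, h2⟩
        obtain ⟨w', h3, h4⟩ := succ_b hw h1
        exact ⟨w', h3, (hY _ ⟨(w', g'), h4⟩).mpr h2⟩
    have e3 : (∀ w', SuccM (mdl A) w w' → w' ∈ Y (A.Ω g.1)) ↔ ∀ g', GC g g' → g' ∈ Y' (A.Ω g.1) := by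
      constructor
      · intro h g' h1
        obtain ⟨w', h3, h4⟩ := succ_b hw h1
        exact (hY _ ⟨(w', g'), h4⟩).mp (h w' h3)
      · intro h w' h1
        obtain ⟨g', h3, h4⟩ := succ_f hw h1
        exact (hY _ ⟨(w', g'), h4⟩).mpr (h g' h3)
    rw [e2, e3]
  · show Fs A (A.c.a1 :: []) = mkRole (Fs A) 1 A.q0 A.root
    rw [Fs_cons, Fs_nil]
    simp [ut, r0, child]

end AC

theorem final (C0 C1 : Set (Frame Unit))
    (h0iso : ClosedUnderIso C0) (h0du : ClosedUnderDU C0)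
    (h1iso : ClosedUnderIso C1) (h1du : ClosedUnderDU C1)
    (hchain : HasChain2 C0) (hedge : HasEdge C1) :
    ∀ n : ℕ, ∃ φ : MuForm (Fin 2), (SigmaMu (n + 1) φ ∨ PiMu (n + 1) φ) ∧
      ∀ ψ : MuForm (Fin 2), (SigmaMu n ψ ∨ PiMu n ψ) →
        ¬ EquivOver (fusion2 C0 C1) φ ψ := by
  intro n
  obtain ⟨c, h0, h1⟩ := exists_ctx h0iso h0du h1iso h1du hchain hedge
  refine diag_main C0 C1 n (th n) (th_noFix n) ?_
  intro f hf
  obtain ⟨Q, δ, Ω, q0, q1, q2, hΩ, hq, hf⟩ := Rec_start hf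
  let A : AC := ⟨c, Q, δ, Ω, q0, q1, q2, hq⟩
  refine ⟨_, frame_mem h0iso h0du h1iso h1du h0 h1 (AC.E A), (AC.mdl A).V, A.root, ?_⟩
  intro env
  rw [hf]
  exact AC.main (A := A) n hΩ env

end AHS

/-- If `∘→∘→∘` is a subframe of `F₀` and `∘→∘` is a subframe of
`F₁`, where `F₀`, `F₁` are classes of unimodal frames closed under isomorphic
copies and disjoint unions, then the μ-calculus' alternation hierarchy is
strict over the fusion `F₀ ⊗ F₁`. -/
theorem alternation_hierarchy_strict_chain_edge
    (C0 C1 : Set (Frame Unit))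
    (h0iso : ClosedUnderIso C0) (h0du : ClosedUnderDU C0)
    (h1iso : ClosedUnderIso C1) (h1du : ClosedUnderDU C1)
    (hchain : HasChain2 C0) (hedge : HasEdge C1) :
    ∀ n : ℕ, ∃ φ : MuForm (Fin 2), (SigmaMu (n + 1) φ ∨ PiMu (n + 1) φ) ∧
      ∀ ψ : MuForm (Fin 2), (SigmaMu n ψ ∨ PiMu n ψ) →
        ¬ EquivOver (fusion2 C0 C1) φ ψ := by
  exact AHS.final C0 C1 h0iso h0du h1iso h1du hchain hedge
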